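/- arXiv:1304.6956 — 2 statements merged into one kernel-verified Lean document; each statement's English description precedes it below -/
import Mathlib

section
/- Let n ≥ 4 and let G be an upper semicontinuous decomposition of ℝⁿ into compact convex sets, and let X = ℝⁿ/G with the quotient topology. Then X has the disjoint arc-disk property in the following sense: the set of pairs (α, f) ∈ C(I, X) × C(D², X) such that α(I) ∩ f(D²) = ∅ is dense in C(I, X) × C(D², X), where each space of continuous maps carries the compact-open topology. (Since X is metrizable, this is equivalent to saying that any two maps α : I → X and f : D² → X can be ε-approximated, for every ε > 0, by maps with disjoint images.) -/
section

open Set Filter Topology Metric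

section NoRetraction

theorem lipschitzWith_indicator_closedBall {E : Type*} [NormedAddCommGroup E]
    [InnerProductSpace ℝ E] {φ : E → E} {R : ℝ} {K : NNReal}
    (hφ : LipschitzOnWith K φ (closedBall 0 R)) (h0 : ∀ x, ‖x‖ = R → φ x = 0) :
    LipschitzWith K ((closedBall 0 R).indicator φ) := by
  have key : ∀ x y : E, ‖x‖ ≤ R → R < ‖y‖ → ‖φ x‖ ≤ K * ‖x - y‖ := by
    intro x y hx hy
    have hc : ContinuousOn (fun s : ℝ => ‖AffineMap.lineMap x y s‖) (Icc 0 1) := by fun_prop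
    obtain ⟨s, hs, hsR⟩ := intermediate_value_Icc (zero_le_one' ℝ) hc
      (show R ∈ Icc _ _ by simp [hx, hy.le])
    have hsR : ‖AffineMap.lineMap x y s‖ = R := hsR
    have h1 := hφ.dist_le_mul x (by simpa using hx) (AffineMap.lineMap x y s)
      (by simp [hsR])
    rw [h0 _ hsR, dist_zero_right, dist_left_lineMap, dist_eq_norm] at h1
    refine h1.trans (mul_le_mul_of_nonneg_left ?_ K.2)
    rw [Real.norm_of_nonneg hs.1]
    exact mul_le_of_le_one_left (norm_nonneg _) hs.2
  refine LipschitzWith.of_dist_le_mul fun x y => ?_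
  by_cases hx : ‖x‖ ≤ R <;> by_cases hy : ‖y‖ ≤ R
  · rw [indicator_of_mem (by simpa using hx), indicator_of_mem (by simpa using hy)]
    exact hφ.dist_le_mul x (by simpa using hx) y (by simpa using hy)
  · rw [indicator_of_mem (by simpa using hx), indicator_of_notMem (by simpa using hy),
      dist_zero_right, dist_eq_norm]
    exact key x y hx (not_le.1 hy)
  · rw [indicator_of_notMem (by simpa using hx), indicator_of_mem (by simpa using hy),
      dist_zero_left, dist_eq_norm, norm_sub_rev]
    exact key y x hy (not_le.1 hx)
  · rw [indicator_of_notMem (by simpa using hx), indicator_of_notMem (by simpa using hy)]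
    simp; positivity

variable {E : Type*} [NormedAddCommGroup E] [InnerProductSpace ℝ E] [FiniteDimensional ℝ E]

/-- Lagrange interpolation for the polynomial `t ↦ det (1 + t A)`, with coefficients independent
of `A`. -/
theorem exists_det_one_add_eq_sum_interpolation {t : ℕ → ℝ} (ht : Function.Injective t) :
    ∃ L : ℕ → ℝ, ∑ j ∈ Finset.range (Module.finrank ℝ E + 1), L j = 1 ∧
      ∀ A : E →L[ℝ] E, (1 + A).det =
        ∑ j ∈ Finset.range (Module.finrank ℝ E + 1), L j * (1 + t j • A).det := by
  classical
  set d := Module.finrank ℝ E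
  set s := Finset.range (d + 1)
  have hinj : Set.InjOn t s := ht.injOn
  have hs : s.Nonempty := ⟨0, by simp [s]⟩
  refine ⟨fun j => (Lagrange.basis s t j).eval 1, ?_, fun A => ?_⟩
  · have := congrArg (Polynomial.eval 1) (Lagrange.sum_basis hinj hs)
    simpa [Polynomial.eval_finsetSum] using this
  · let b := Module.finBasis ℝ E
    let M := LinearMap.toMatrix b b (A : E →ₗ[ℝ] E)
    let P : Polynomial ℝ := Matrix.det ((Polynomial.X : Polynomial ℝ) • M.map Polynomial.C +
      (1 : Matrix (Fin d) (Fin d) ℝ).map Polynomial.C)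
    have hP : ∀ r : ℝ, P.eval r = (1 + r • A).det := by
      intro r
      have h1 : (1 + r • A).det = Matrix.det (LinearMap.toMatrix b b
          ((1 + r • A : E →L[ℝ] E) : E →ₗ[ℝ] E)) := by
        rw [LinearMap.det_toMatrix]
      have h2 : LinearMap.toMatrix b b ((1 + r • A : E →L[ℝ] E) : E →ₗ[ℝ] E) = r • M + 1 := by
        have : ((1 + r • A : E →L[ℝ] E) : E →ₗ[ℝ] E) = LinearMap.id + r • (A : E →ₗ[ℝ] E) := rfl
        rw [this, map_add, map_smul, LinearMap.toMatrix_id, add_comm]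
      rw [h1, h2]
      change (Polynomial.evalRingHom r) P = _
      rw [RingHom.map_det]
      congr 1
      ext i j
      simp [Matrix.one_apply]
      split_ifs <;> simp [mul_comm]
    have hdeg : P.degree < s.card := by
      refine (Polynomial.degree_le_of_natDegree_le
        (Polynomial.natDegree_det_X_add_C_le M 1)).trans_lt ?_
      simp [s]
      exact_mod_cast Nat.lt_succ_self d
    have h := congrArg (Polynomial.eval 1) (Lagrange.eq_interpolate hinj hdeg)
    rw [hP, one_smul, Lagrange.interpolate_apply, Polynomial.eval_finsetSum] at h
    rw [h]
    refine Finset.sum_congr rfl fun j _ => ?_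
    simp [hP, mul_comm]

theorem det_one_add_pos {A : E →L[ℝ] E} (hA : ‖A‖ < 1) : 0 < (1 + A).det := by
  have hne : ∀ s ∈ Icc (0 : ℝ) 1, (1 + s • A).det ≠ 0 := by
    intro s hs h
    have h' : LinearMap.det ((1 + s • A : E →L[ℝ] E) : E →ₗ[ℝ] E) = 0 := h
    obtain ⟨v, hv, hv0⟩ := (Submodule.ne_bot_iff _).1 (LinearMap.bot_lt_ker_of_det_eq_zero h').ne'
    have hv1 : v + s • A v = 0 := by simpa using hv
    have h2 : ‖v‖ = s * ‖A v‖ := by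
      rw [eq_neg_of_add_eq_zero_left hv1, norm_neg, norm_smul, Real.norm_of_nonneg hs.1]
      congr 2
      rw [← eq_neg_of_add_eq_zero_left hv1]
    have h3 : s * ‖A v‖ ≤ 1 * (‖A‖ * ‖v‖) :=
      mul_le_mul hs.2 (A.le_opNorm v) (norm_nonneg _) zero_le_one
    have h4 : 0 < ‖v‖ := norm_pos_iff.2 hv0
    nlinarith
  have hc : Continuous fun s : ℝ => (1 + s • A).det :=
    ContinuousLinearMap.continuous_det.comp (by fun_prop)
  by_contra hneg
  obtain ⟨s, hs, h⟩ := intermediate_value_Icc' (zero_le_one' ℝ) hc.continuousOn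
    (show (0 : ℝ) ∈ Icc _ _ by
      simp only [zero_smul, one_smul, add_zero]
      refine ⟨not_lt.1 hneg, ?_⟩
      simp [ContinuousLinearMap.det])
  exact hne s hs h

open MeasureTheory in
theorem integral_det_one_add_smul_fderiv [MeasurableSpace E] [BorelSpace E] {φ : E → E} {R : ℝ}
    (hφ : ContDiff ℝ 1 φ) (h0 : ∀ x, ‖x‖ = R → φ x = 0) :
    ∃ ε > 0, ∀ t ∈ Ioo (0 : ℝ) ε,
      ∫ x in ball (0 : E) R, (1 + t • fderiv ℝ φ x).det = volume.real (ball (0 : E) R) := by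
  obtain ⟨K, hK⟩ : ∃ K, LipschitzOnWith K φ (closedBall 0 R) :=
    (hφ.locallyLipschitz.locallyLipschitzOn).exists_lipschitzOnWith_of_compact
      (isCompact_closedBall _ _)
  have hL := lipschitzWith_indicator_closedBall hK h0
  set g := (closedBall (0 : E) R).indicator φ with hg
  refine ⟨1 / (K + 1), by positivity, fun t ht => ?_⟩
  have htK : t * K < 1 := by
    have h1 : t * (K + 1) < 1 := (lt_div_iff₀ (by positivity)).1 ht.2
    nlinarith [ht.1]
  let f : E → E := fun x => x + t • g x
  let c : NNReal := ⟨t * K, mul_nonneg ht.1.le K.2⟩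
  have hf : ∀ x y, ‖f x - f y - (x - y)‖ ≤ c * ‖x - y‖ := by
    intro x y
    have : f x - f y - (x - y) = t • (g x - g y) := by simp only [f]; module
    rw [this, norm_smul, Real.norm_of_nonneg ht.1.le]
    have h1 := hL.dist_le_mul x y
    rw [dist_eq_norm, dist_eq_norm] at h1
    change _ ≤ t * K * _
    rw [mul_assoc]
    exact mul_le_mul_of_nonneg_left h1 ht.1.le
  have hc : (c : ℝ) < 1 := htK
  have hinj : Function.Injective f := by
    intro x y hxy
    have h1 := hf x y
    rw [hxy, sub_self, zero_sub, norm_neg] at h1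
    by_contra hne
    have : 0 < ‖x - y‖ := norm_pos_iff.2 (sub_ne_zero.2 hne)
    nlinarith
  have hsurj : Function.Surjective f := by
    have happ : ApproximatesLinearOn f ((ContinuousLinearEquiv.refl ℝ E : E ≃L[ℝ] E) : E →L[ℝ] E)
        univ c := fun x _ y _ => by simpa using hf x y
    refine happ.surjective ?_
    rcases subsingleton_or_nontrivial E with h | h
    · exact Or.inl h
    · right
      have : ‖((ContinuousLinearEquiv.refl ℝ E).symm : E →L[ℝ] E)‖₊ = 1 := by
        have h1 : ‖ContinuousLinearMap.id ℝ E‖₊ = 1 := by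
          ext; simp
        exact h1
      rw [this, inv_one]
      exact hc
  have hout : ∀ x, x ∉ ball (0 : E) R → f x = x := by
    intro x hx
    have hx : R ≤ ‖x‖ := by simpa using hx
    have : g x = 0 := by
      rcases hx.eq_or_lt with h | h
      · rw [hg, indicator_of_mem (by simp [h]), h0 x h.symm]
      · rw [hg, indicator_of_notMem (by simpa using h)]
    simp [f, this]
  have himg : f '' ball 0 R = ball 0 R := by
    ext y
    constructor
    · rintro ⟨x, hx, rfl⟩
      by_contra hy
      exact hy ((hinj (hout _ hy)).symm ▸ hx)
    · intro hy
      obtain ⟨x, rfl⟩ := hsurj y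
      by_contra hx
      have : x ∉ ball (0 : E) R := fun h => hx ⟨x, h, rfl⟩
      exact this (hout x this ▸ hy)
  have hder : ∀ x ∈ ball (0 : E) R,
      HasFDerivAt f (1 + t • fderiv ℝ φ x) x := by
    intro x hx
    have h1 : HasFDerivAt φ (fderiv ℝ φ x) x :=
      (hφ.differentiable one_ne_zero x).hasFDerivAt
    have h2 : HasFDerivAt (fun y => y + t • φ y) (1 + t • fderiv ℝ φ x) x :=
      (hasFDerivAt_id x).add (h1.const_smul t)
    refine h2.congr_of_eventuallyEq ?_
    filter_upwards [isOpen_ball.mem_nhds hx] with y hy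
    simp only [f, hg]
    rw [indicator_of_mem (ball_subset_closedBall hy)]
  have hnorm : ∀ x ∈ ball (0 : E) R, ‖t • fderiv ℝ φ x‖ < 1 := by
    intro x hx
    have h1 : ‖fderiv ℝ φ x‖ ≤ K :=
      norm_fderiv_le_of_lipschitzOn ℝ (mem_of_superset (isOpen_ball.mem_nhds hx)
        ball_subset_closedBall) hK
    rw [norm_smul, Real.norm_of_nonneg ht.1.le]
    exact (mul_le_mul_of_nonneg_left h1 ht.1.le).trans_lt htK
  have hcov := integral_image_eq_integral_abs_det_fderiv_smul volume
    (measurableSet_ball : MeasurableSet (ball (0 : E) R))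
    (fun x hx => (hder x hx).hasFDerivWithinAt) hinj.injOn (fun _ => (1 : ℝ))
  rw [himg] at hcov
  simp only [smul_eq_mul, mul_one, integral_const, measureReal_restrict_apply_univ] at hcov
  rw [hcov]
  refine setIntegral_congr_fun measurableSet_ball fun x hx => ?_
  exact (abs_of_pos (det_one_add_pos (hnorm x hx))).symm

open MeasureTheory in
theorem exists_eq_zero_of_contDiff {ψ : E → E} {r : ℝ} (hψ : ContDiff ℝ 1 ψ)
    (hid : ∀ x, r ≤ ‖x‖ → ψ x = x) : ∃ x, ψ x = 0 := by
  by_contra! hne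
  borelize E
  set R : ℝ := |r| + 1
  have hR : 0 < R := by positivity
  have hrR : r ≤ R := (le_abs_self r).trans (by simp [R])
  let f : E → E := fun x => (R * ‖ψ x‖⁻¹) • ψ x
  have hfsm : ContDiff ℝ 1 f := by
    refine ContDiff.smul (contDiff_const.mul ?_) hψ
    exact (hψ.norm ℝ hne).inv fun x => norm_ne_zero_iff.2 (hne x)
  have hfn : ∀ x, inner ℝ (f x) (f x) = R ^ 2 := by
    intro x
    have : ‖ψ x‖ ≠ 0 := norm_ne_zero_iff.2 (hne x)
    rw [real_inner_self_eq_norm_sq, norm_smul, norm_mul, norm_inv, norm_norm,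
      Real.norm_of_nonneg hR.le]
    field_simp
  let φ : E → E := fun x => f x - x
  have hφ : ContDiff ℝ 1 φ := hfsm.sub contDiff_id
  have h0 : ∀ x, ‖x‖ = R → φ x = 0 := by
    intro x hx
    simp only [φ, f]
    rw [hid x (hx ▸ hrR), hx, mul_inv_cancel₀ hR.ne', one_smul, sub_self]
  have hdet : ∀ x, (1 + fderiv ℝ φ x).det = 0 := by
    intro x
    have hfx : HasFDerivAt f (fderiv ℝ f x) x :=
      (hfsm.differentiable one_ne_zero x).hasFDerivAt
    have h1 : 1 + fderiv ℝ φ x = fderiv ℝ f x := by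
      have : HasFDerivAt φ (fderiv ℝ f x - 1) x := hfx.sub (hasFDerivAt_id x)
      rw [this.fderiv]; abel
    rw [h1]
    by_contra hd
    have hsurj : Function.Surjective (fderiv ℝ f x) := by
      have hu : IsUnit (LinearMap.det (fderiv ℝ f x : E →ₗ[ℝ] E)) := isUnit_iff_ne_zero.2 hd
      exact (Module.End.isUnit_iff _).1 ((LinearMap.isUnit_iff_isUnit_det _).2 hu) |>.2
    have h2 := hfx.inner ℝ hfx
    have h3 : HasFDerivAt (fun y => inner ℝ (f y) (f y)) (0 : E →L[ℝ] ℝ) x := by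
      simp only [hfn]
      exact hasFDerivAt_const _ _
    have h4 := h2.unique h3
    obtain ⟨v, hv⟩ := hsurj (f x)
    have h5 := congrArg (fun T : E →L[ℝ] ℝ => T v) h4
    simp [hv, fderivInnerCLM_apply] at h5
    have h6 := hfn x
    rw [h5, inner_zero_left] at h6
    exact (pow_pos hR 2).ne h6
  obtain ⟨ε, hε, hint⟩ := integral_det_one_add_smul_fderiv hφ h0
  let t : ℕ → ℝ := fun j => ε / (j + 2)
  have ht : ∀ j, t j ∈ Ioo 0 ε := by
    intro j
    refine ⟨by positivity, ?_⟩
    rw [div_lt_iff₀ (by positivity)]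
    have : (0 : ℝ) ≤ j := j.cast_nonneg
    nlinarith
  have htinj : Function.Injective t := by
    intro i j hij
    simp only [t] at hij
    rw [div_eq_div_iff (by positivity) (by positivity)] at hij
    have := mul_left_cancel₀ hε.ne' hij
    have h : (j : ℝ) = i := by linarith
    exact_mod_cast h.symm
  obtain ⟨L, hL1, hL⟩ := exists_det_one_add_eq_sum_interpolation (E := E) htinj
  have hcont : ∀ j, Continuous fun x => (1 + t j • fderiv ℝ φ x).det := fun j =>
    have h := hφ.continuous_fderiv one_ne_zero
    ContinuousLinearMap.continuous_det.comp (by fun_prop)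
  have hI : ∀ j, IntegrableOn (fun x => (1 + t j • fderiv ℝ φ x).det) (ball (0 : E) R) := fun j =>
    ((hcont j).continuousOn.integrableOn_compact (isCompact_closedBall 0 R)).mono_set
      ball_subset_closedBall
  have hsum : (0 : ℝ) = volume.real (ball (0 : E) R) := by
    calc (0 : ℝ) = ∫ x in ball (0 : E) R, (1 + fderiv ℝ φ x).det := by simp [hdet]
      _ = ∫ x in ball (0 : E) R, ∑ j ∈ Finset.range (Module.finrank ℝ E + 1),
          L j * (1 + t j • fderiv ℝ φ x).det := by
          congr with x
          exact hL _
      _ = ∑ j ∈ Finset.range (Module.finrank ℝ E + 1), L j * volume.real (ball (0 : E) R) := by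
          rw [integral_finsetSum _ fun j _ => (hI j).const_mul _]
          refine Finset.sum_congr rfl fun j _ => ?_
          rw [integral_const_mul, hint _ (ht j)]
      _ = _ := by rw [← Finset.sum_mul, hL1, one_mul]
  have hpos : 0 < volume.real (ball (0 : E) R) :=
    ENNReal.toReal_pos (measure_ball_pos volume _ hR).ne' measure_ball_lt_top.ne
  exact hpos.ne hsum

/-- A continuous self-map of a Euclidean space which is the identity outside a bounded set is
surjective. -/
theorem surjective_of_continuous_of_eq_id_of_le_norm {ψ : E → E} {r : ℝ} (hψ : Continuous ψ)
    (hid : ∀ x, r ≤ ‖x‖ → ψ x = x) : Function.Surjective ψ := by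
  intro a
  by_contra! hne
  let χ : E → E := fun x => ψ (x + a) - a
  have hχ : Continuous χ := by fun_prop
  have hχ0 : ∀ x, χ x ≠ 0 := fun x h => hne (x + a) (sub_eq_zero.1 h)
  have hχid : ∀ x, r + ‖a‖ ≤ ‖x‖ → χ x = x := by
    intro x hx
    have h1 : r ≤ ‖x + a‖ := by
      have := norm_sub_norm_le x (-a)
      rw [sub_neg_eq_add, norm_neg] at this
      linarith
    simp [χ, hid _ h1]
  let U : Set E := {x | r + ‖a‖ < ‖x‖}
  let T : Set E := {x | r + ‖a‖ + 1 ≤ ‖x‖}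
  have hU : IsOpen U := isOpen_lt continuous_const continuous_norm
  have hT : IsClosed T := isClosed_le continuous_const continuous_norm
  have hTU : T ⊆ U := fun x hx => by
    have hx : r + ‖a‖ + 1 ≤ ‖x‖ := hx
    change r + ‖a‖ < ‖x‖
    linarith
  have hsm : ContDiffOn ℝ ((1 : ℕ∞) : WithTop ℕ∞) χ U :=
    contDiffOn_id.congr fun x hx => hχid x (le_of_lt hx)
  obtain ⟨g, hg, hgχ, hgT, -⟩ := hχ.exists_contDiff_approx_and_eqOn 1 hχ.norm
    (fun x => norm_pos_iff.2 (hχ0 x)) hT (hU.mem_nhdsSet.2 hTU) hsm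
  obtain ⟨x, hx⟩ := exists_eq_zero_of_contDiff (r := r + ‖a‖ + 1) (by exact_mod_cast hg)
    fun x hx => (hgT hx).trans (hχid x (hTU hx).le)
  have := hgχ x
  rw [hx, dist_zero_left] at this
  exact lt_irrefl _ this

end NoRetraction

section HomotopyExtension

theorem exists_extension_of_segment {X F : Type*} [TopologicalSpace X] [T2Space X] [NormalSpace X]
    [NormedAddCommGroup F] [NormedSpace ℝ F] {K C : Set X} (hK : IsCompact K) (hC : IsClosed C)
    {u v e : X → F} (hu : Continuous u) (hv : Continuous v) (he : Continuous e)
    (huv : ∀ x ∈ C, 0 ∉ segment ℝ (u x) (v x)) (heu : EqOn e u C) (he0 : ∀ x ∈ K, e x ≠ 0) :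
    ∃ e' : X → F, Continuous e' ∧ EqOn e' v C ∧ ∀ x ∈ K, e' x ≠ 0 := by
  let H : X × ℝ → F := fun p => e p.1 + p.2 • (v p.1 - u p.1)
  have hH : Continuous H := by fun_prop
  let Z : Set X := Prod.fst '' ((K ×ˢ Icc (0 : ℝ) 1) ∩ H ⁻¹' {0})
  have hZ : IsClosed Z :=
    (((hK.prod isCompact_Icc).inter_right (isClosed_singleton.preimage hH)).image
      continuous_fst).isClosed
  have hdisj : Disjoint Z C := by
    rw [Set.disjoint_left]
    rintro _ ⟨⟨x, s⟩, ⟨⟨hx, hs⟩, h0⟩, rfl⟩ hxC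
    refine huv x hxC ?_
    rw [segment_eq_image']
    refine ⟨s, hs, ?_⟩
    have : e x + s • (v x - u x) = 0 := h0
    rwa [heu hxC] at this
  obtain ⟨l, hl0, hl1, hl⟩ := exists_continuous_zero_one_of_isClosed hZ hC hdisj
  refine ⟨fun x => H (x, l x), by fun_prop, fun x hx => ?_, fun x hx h0 => ?_⟩
  · have : l x = 1 := hl1 hx
    simp [H, this, heu hx]
  · have hxZ : x ∈ Z := ⟨(x, l x), ⟨⟨hx, hl x⟩, h0⟩, rfl⟩
    have hlx : l x = 0 := hl0 hxZ
    refine he0 x hx ?_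
    simpa [H, hlx] using h0

end HomotopyExtension

theorem zero_notMem_segment_sub_left {F : Type*} [NormedAddCommGroup F] [NormedSpace ℝ F]
    {x y a : F} (h : a ∉ segment ℝ x y) : 0 ∉ segment ℝ (x - a) (y - a) := by
  rw [segment_eq_image'] at h ⊢
  rintro ⟨s, hs, h0⟩
  refine h ⟨s, hs, ?_⟩
  rw [← sub_eq_zero, ← h0]
  module

theorem zero_notMem_segment_sub_right {F : Type*} [NormedAddCommGroup F] [NormedSpace ℝ F]
    {a b y : F} (h : y ∉ segment ℝ a b) : 0 ∉ segment ℝ (y - a) (y - b) := by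
  rw [segment_eq_image'] at h ⊢
  rintro ⟨s, hs, h0⟩
  refine h ⟨s, hs, ?_⟩
  rw [← sub_eq_zero, ← neg_eq_zero, ← h0]
  module

section Separation

variable {E : Type*} [NormedAddCommGroup E] [InnerProductSpace ℝ E] [FiniteDimensional ℝ E]

/-- A closed set `B` does not separate `a` from `b` in a bounded open set `U` if it can be pushed,
relative to the complement of `U`, off a path from `b` to `a`, with tracks missing `a` and `b`. -/
theorem joinedIn_diff_of_push {U B : Set E} {a b m : E} {h : E → E}
    (hU : IsOpen U) (hUb : Bornology.IsBounded U) (hB : IsClosed B) (ha : a ∈ U \ B) (hb : b ∈ U \ B)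
    (hbm : segment ℝ b m ⊆ U) (hma : segment ℝ m a ⊆ U) (hh : Continuous h)
    (hid : ∀ x ∉ U, h x = x) (hBa : ∀ x ∈ B, a ∉ segment ℝ x (h x))
    (hBb : ∀ x ∈ B, b ∉ segment ℝ x (h x)) (hBbm : ∀ x ∈ B, h x ∉ segment ℝ b m)
    (hBma : ∀ x ∈ B, h x ∉ segment ℝ m a) : JoinedIn (U \ B) a b := by
  by_contra hab
  have hO : IsOpen (U \ B) := hU.sdiff hB
  let A := pathComponentIn (U \ B) a
  have hAo : IsOpen A := hO.pathComponentIn a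
  have hAU : A ⊆ U \ B := pathComponentIn_subset
  have haA : a ∈ A := mem_pathComponentIn_self ha
  have hAK : IsCompact (closure A) := (hUb.subset (hAU.trans sdiff_subset)).isCompact_closure
  have hclos : ∀ x ∈ closure A, x ∈ U \ B → x ∈ A := by
    intro x hx hxO
    obtain ⟨y, hy, hyA⟩ := mem_closure_iff.1 hx _ (hO.pathComponentIn x)
      (mem_pathComponentIn_self hxO)
    have hxy : JoinedIn (U \ B) x y := hy
    have hay : JoinedIn (U \ B) a y := hyA
    exact hay.trans hxy.symm
  have hfr : ∀ x ∈ frontier A, x ∉ U ∨ x ∈ B := by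
    intro x hx
    by_contra! hxO
    rw [frontier, hAo.interior_eq] at hx
    exact hx.2 (hclos x hx.1 hxO)
  have hbA : b ∉ closure A := fun h => hab (hclos b h hb)
  have step : ∀ p ∈ U, ∀ q ∈ U, segment ℝ p q ⊆ U → (∀ x ∈ B, h x ∉ segment ℝ p q) →
      ∀ x ∈ frontier A, 0 ∉ segment ℝ (h x - p) (h x - q) := by
    intro p hp q hq hpq hB' x hx
    refine zero_notMem_segment_sub_right ?_
    rcases hfr x hx with hxU | hxB
    · rw [hid x hxU]
      exact fun h' => hxU (hpq h')
    · exact hB' x hxB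
  have step' : ∀ p ∈ U, (∀ x ∈ B, p ∉ segment ℝ x (h x)) →
      ∀ x ∈ frontier A, 0 ∉ segment ℝ (x - p) (h x - p) := by
    intro p hp hB' x hx
    refine zero_notMem_segment_sub_left ?_
    rcases hfr x hx with hxU | hxB
    · rw [hid x hxU, segment_same]
      rintro rfl
      exact hxU hp
    · exact hB' x hxB
  have hmU : m ∈ U := hbm (right_mem_segment ℝ b m)
  have hC : IsClosed (frontier A) := isClosed_frontier
  obtain ⟨e₁, he₁, he₁C, he₁0⟩ := exists_extension_of_segment (u := fun x => x - b)
    (v := fun x => h x - b) (e := fun x => x - b) hAK hC (by fun_prop) (by fun_prop) (by fun_prop)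
    (step' b hb.1 hBb) (fun _ _ => rfl) (fun x hx h0 => hbA (sub_eq_zero.1 h0 ▸ hx))
  obtain ⟨e₂, he₂, he₂C, he₂0⟩ := exists_extension_of_segment (v := fun x => h x - m)
    hAK hC (by fun_prop) (by fun_prop) he₁ (step b hb.1 m hmU hbm hBbm) he₁C he₁0
  obtain ⟨e₃, he₃, he₃C, he₃0⟩ := exists_extension_of_segment (v := fun x => h x - a)
    hAK hC (by fun_prop) (by fun_prop) he₂ (step m hmU a ha.1 hma hBma) he₂C he₂0
  obtain ⟨e₄, he₄, he₄C, he₄0⟩ := exists_extension_of_segment (v := fun x => x - a)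
    hAK hC (by fun_prop) (by fun_prop) he₃
    (fun x hx => by rw [segment_symm]; exact step' a ha.1 hBa x hx) he₃C he₃0
  classical
  let ψ : E → E := fun x => if x ∈ A then e₄ x + a else x
  have hψ : Continuous ψ := by
    refine Continuous.if (fun x hx => ?_) (by fun_prop) continuous_id
    have := he₄C hx
    simp [this]
  obtain ⟨r, hr⟩ := hUb.subset_ball (0 : E)
  have hψid : ∀ x, r ≤ ‖x‖ → ψ x = x := by
    intro x hx
    refine if_neg fun hxA => ?_
    have := hr (hAU hxA).1
    simp at this
    linarith
  obtain ⟨x, hx⟩ := surjective_of_continuous_of_eq_id_of_le_norm hψ hψid a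
  by_cases hxA : x ∈ A
  · simp only [ψ, if_pos hxA] at hx
    exact he₄0 x (subset_closure hxA) (by simpa using hx)
  · simp only [ψ, if_neg hxA] at hx
    exact hxA (hx ▸ haA)

end Separation

theorem IsClosedMap.eventually_preimage_singleton_subset {E X : Type*} [TopologicalSpace E]
    [TopologicalSpace X] {π : E → X} (hπ : IsClosedMap π) (hc : Continuous π) {V : Set E}
    (hV : IsOpen V) : IsOpen {x | π ⁻¹' {π x} ⊆ V} := by
  have : {x | π ⁻¹' {π x} ⊆ V} = π ⁻¹' (π '' Vᶜ)ᶜ := by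
    ext x
    simp only [mem_ofPred_eq, preimage_compl, mem_compl_iff, mem_preimage, mem_image, not_exists,
      not_and]
    constructor
    · intro h y hy hyx
      exact hy (h hyx)
    · intro h y hyx
      by_contra hy
      exact h y hy hyx
  rw [this]
  exact (hπ _ hV.isClosed_compl).isOpen_compl.preimage hc

section Push

variable {E X : Type*} [NormedAddCommGroup E] [InnerProductSpace ℝ E]
  [TopologicalSpace X] {π : E → X}

theorem exists_approximate_selection (hπ : IsProperMap π) (hconv : ∀ x, Convex ℝ (π ⁻¹' {x}))
    {σ : Set E} (hσ : IsCompact σ) (hσc : Convex ℝ σ) {ε : ℝ} (hε : 0 < ε) :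
    ∃ h : E → E, Continuous h ∧ ∀ x ∈ π ⁻¹' (π '' σ), h x ∈ σ ∧ ∃ x' ∈ π ⁻¹' (π '' σ),
      x ∈ thickening ε {x'} ∧ segment ℝ x (h x) ⊆ thickening ε (π ⁻¹' {π x'}) := by
  set B := π ⁻¹' (π '' σ) with hB
  have hBc : IsCompact B := hπ.isCompact_preimage (hσ.image hπ.continuous)
  let c : E → Set E := fun x => {y | π ⁻¹' {π y} ⊆ thickening ε (π ⁻¹' {π x})} ∩ ball x ε
  obtain ⟨δ, hδ, hleb⟩ := lebesgue_number_lemma_of_metric (c := fun x : B => c x) hBc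
    (fun x => (hπ.isClosedMap.eventually_preimage_singleton_subset hπ.continuous
      isOpen_thickening).inter isOpen_ball)
    (fun x hx => mem_iUnion.2 ⟨⟨x, hx⟩, self_subset_thickening hε _, mem_ball_self hε⟩)
  have hleb' : ∀ x, ∃ z, x ∈ B → z ∈ B ∧ ball x δ ⊆ c z := fun x => by
    by_cases hx : x ∈ B
    · obtain ⟨z, hz⟩ := hleb x hx
      exact ⟨z, fun _ => ⟨z.2, hz⟩⟩
    · exact ⟨0, fun h => absurd h hx⟩
  choose i hi using hleb'
  classical
  let t : E → Set E := fun x =>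
    if x ∈ B then σ ∩ thickening ε (π ⁻¹' {π (i x)}) else univ
  have ht : ∀ x, Convex ℝ (t x) := by
    intro x
    simp only [t]
    split_ifs
    · exact hσc.inter ((hconv _).thickening ε)
    · exact convex_univ
  obtain ⟨h, hh⟩ := exists_continuous_forall_mem_convex_of_local_const ht (by
    intro x
    by_cases hx : x ∈ B
    · obtain ⟨y, hyσ, hyx⟩ := hx
      refine ⟨y, ?_⟩
      filter_upwards [ball_mem_nhds x hδ] with z hz
      simp only [t]
      split_ifs with hzB
      · have hxc : x ∈ c (i z) := (hi z hzB).2 (by rwa [mem_ball_comm])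
        exact ⟨hyσ, hxc.1 hyx⟩
      · trivial
    · refine ⟨0, ?_⟩
      filter_upwards [hBc.isClosed.isOpen_compl.mem_nhds hx] with z hz
      simp only [t]
      rw [if_neg hz]
      trivial)
  refine ⟨h, h.continuous, fun x hx => ?_⟩
  have hxt := hh x
  simp only [t, if_pos hx] at hxt
  have hxc : x ∈ c (i x) := (hi x hx).2 (mem_ball_self hδ)
  refine ⟨hxt.1, i x, (hi x hx).1, ?_, ?_⟩
  · rw [thickening_singleton]
    exact hxc.2
  · exact ((hconv _).thickening ε).segment_subset (hxc.1 rfl) hxt.2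

theorem exists_push (hπ : IsProperMap π) (hconv : ∀ x, Convex ℝ (π ⁻¹' {x}))
    {σ : Set E} (hσ : IsCompact σ) (hσc : Convex ℝ σ) {K V W U : Set E} (hK : IsCompact K)
    (hV : IsOpen V) (hKV : K ⊆ V) (hW : IsCompact W) (hVW : ∀ x, (π ⁻¹' {π x} ∩ V).Nonempty → x ∈ W)
    (hU : IsOpen U) (hWU : W ⊆ U) (hKσ : Disjoint K σ) {η : ℝ} (hη : 0 < η) :
    ∃ h : E → E, Continuous h ∧ (∀ x ∉ U, h x = x) ∧ ∀ x ∈ π ⁻¹' (π '' σ),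
      h x ∉ K ∧ segment ℝ x (h x) ⊆ thickening η (π ⁻¹' (π '' σ)) := by
  obtain ⟨ε₁, hε₁, hKε⟩ := hK.exists_thickening_subset_open hV hKV
  obtain ⟨ε₂, hε₂, hWε⟩ := hW.exists_cthickening_subset_open hU hWU
  set ε := min η (min ε₁ ε₂)
  have hε : 0 < ε := by positivity
  obtain ⟨h, hh, hsel⟩ := exists_approximate_selection hπ hconv hσ hσc hε
  obtain ⟨l, hl0, hl1, hl⟩ := exists_continuous_zero_one_of_isClosed hU.isClosed_compl
    (isClosed_cthickening (δ := ε₂) (E := W))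
    (Set.disjoint_left.2 fun x hx hx' => hx (hWε hx'))
  have hmem : ∀ x, x + l x • (h x - x) ∈ segment ℝ x (h x) := fun x => by
    rw [segment_eq_image']
    exact ⟨l x, hl x, rfl⟩
  refine ⟨fun x => x + l x • (h x - x), by fun_prop, fun x hx => ?_, fun x hx => ?_⟩
  · have : l x = 0 := hl0 hx
    simp [this]
  · obtain ⟨hxσ, x', hx', hxx', hseg⟩ := hsel x hx
    refine ⟨fun hxK => ?_, ?_⟩
    · by_cases hxW : x ∈ cthickening ε₂ W
      · have h1 : l x = 1 := hl1 hxW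
        simp only [h1, one_smul, add_sub_cancel] at hxK
        exact Set.disjoint_left.1 hKσ hxK hxσ
      · have hx'W : x' ∉ W := by
          intro hx'W
          refine hxW (thickening_subset_cthickening _ _ ?_)
          exact thickening_mono ((min_le_right _ _).trans (min_le_right _ _)) _
            (thickening_subset_of_subset _ (singleton_subset_iff.2 hx'W) hxx')
        obtain ⟨y, hy, hxy⟩ := mem_thickening_iff.1 (hseg (hmem x))
        refine hx'W (hVW x' ⟨y, hy, hKε ?_⟩)
        refine mem_thickening_iff.2 ⟨_, hxK, ?_⟩
        rw [dist_comm]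
        exact hxy.trans_le ((min_le_right _ _).trans (min_le_left _ _))
    · refine ((convex_segment x (h x)).segment_subset (left_mem_segment ℝ _ _) (hmem x)).trans ?_
      refine hseg.trans ((thickening_mono (min_le_left _ _) _).trans
        (thickening_subset_of_subset _ ?_))
      intro y hy
      have hy : π y = π x' := hy
      change π y ∈ π '' σ
      rw [hy]
      exact hx'

variable [FiniteDimensional ℝ E]

/-- Every open saturated neighbourhood of a fibre contains a convex neighbourhood whose saturation
lies in a compact part of it. -/
theorem exists_convex_nhd_fiber (hπ : IsProperMap π) (hconv : ∀ x, Convex ℝ (π ⁻¹' {x})) (x₀ : E)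
    {O : Set E} (hO : IsOpen O) (hx₀ : π ⁻¹' {π x₀} ⊆ O) :
    ∃ V W : Set E, IsOpen V ∧ Convex ℝ V ∧ π ⁻¹' {π x₀} ⊆ V ∧ IsCompact W ∧ W ⊆ O ∧ V ⊆ W ∧
      ∀ x, (π ⁻¹' {π x} ∩ V).Nonempty → x ∈ W := by
  have hO' := hπ.isClosedMap.eventually_preimage_singleton_subset hπ.continuous hO
  have hfc : IsCompact (π ⁻¹' {π x₀}) := hπ.isCompact_preimage isCompact_singleton
  obtain ⟨δ, hδ, hsub⟩ := hfc.exists_cthickening_subset_open hO' (by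
    intro y hy
    have hy : π y = π x₀ := hy
    change π ⁻¹' {π y} ⊆ O
    rwa [hy])
  have hVW : thickening δ (π ⁻¹' {π x₀}) ⊆ π ⁻¹' (π '' (cthickening δ (π ⁻¹' {π x₀}))) :=
    (thickening_subset_cthickening _ _).trans (subset_preimage_image _ _)
  refine ⟨thickening δ (π ⁻¹' {π x₀}), π ⁻¹' (π '' (cthickening δ (π ⁻¹' {π x₀}))),
    isOpen_thickening, (hconv _).thickening δ, self_subset_thickening hδ _,
    hπ.isCompact_preimage (hfc.cthickening.image hπ.continuous), ?_, hVW, ?_⟩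
  · rintro x ⟨y, hy, hyx⟩
    exact hsub hy hyx.symm
  · rintro x ⟨y, hyx, hyV⟩
    exact ⟨y, thickening_subset_cthickening _ _ hyV, hyx⟩

theorem measure_convexHull_eq_zero [MeasurableSpace E] [BorelSpace E]
    (μ : MeasureTheory.Measure E) [μ.IsAddHaarMeasure] {T : Finset E}
    (hT : T.card ≤ Module.finrank ℝ E) : μ (affineSpan ℝ (T : Set E)) = 0 := by
  refine MeasureTheory.Measure.addHaar_affineSubspace _ _ fun htop => ?_
  rcases T.eq_empty_or_nonempty with rfl | hne
  · simp at htop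
  have hpos := hne.card_pos
  classical
  have h1 : Module.finrank ℝ (vectorSpan ℝ (T : Set E)) ≤ T.card - 1 := by
    have := finrank_vectorSpan_image_finset_le ℝ id T (n := T.card - 1) (by omega)
    rwa [Finset.image_id] at this
  have h2 : (affineSpan ℝ (T : Set E)).direction = ⊤ := by
    rw [htop, AffineSubspace.direction_top]
  rw [direction_affineSpan] at h2
  rw [h2, finrank_top] at h1
  omega

open MeasureTheory in
theorem exists_segments_disjoint_convexHull {T : Finset E} (hT : T.card < Module.finrank ℝ E)
    {V : Set E} (hV : IsOpen V) (hVne : V.Nonempty) {a b : E} (ha : a ∉ convexHull ℝ (T : Set E))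
    (hb : b ∉ convexHull ℝ (T : Set E)) :
    ∃ m ∈ V, Disjoint (segment ℝ b m) (convexHull ℝ (T : Set E)) ∧
      Disjoint (segment ℝ m a) (convexHull ℝ (T : Set E)) := by
  classical
  borelize E
  have hnull : ∀ p : E, volume ((affineSpan ℝ ((insert p T : Finset E) : Set E) : Set E)) = 0 :=
    fun p => measure_convexHull_eq_zero _ ((Finset.card_insert_le _ _).trans hT)
  have hne : ¬ V ⊆ affineSpan ℝ ((insert a T : Finset E) : Set E) ∪
      affineSpan ℝ ((insert b T : Finset E) : Set E) := fun hsub =>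
    (hV.measure_pos volume hVne).ne' (measure_mono_null hsub
      (measure_union_null (hnull a) (hnull b)))
  obtain ⟨m, hmV, hm⟩ := not_subset.1 hne
  simp only [mem_union, not_or] at hm
  have key : ∀ p : E, p ∉ convexHull ℝ (T : Set E) →
      m ∉ (affineSpan ℝ ((insert p T : Finset E) : Set E) : Set E) →
      Disjoint (segment ℝ p m) (convexHull ℝ (T : Set E)) := by
    intro p hp hmp
    rw [Set.disjoint_left]
    intro q hq hqT
    rw [segment_eq_image_lineMap] at hq
    obtain ⟨s, hs, rfl⟩ := hq
    have hs0 : s ≠ 0 := by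
      rintro rfl
      simp only [AffineMap.lineMap_apply_zero] at hqT
      exact hp hqT
    refine hmp ?_
    have hpS : p ∈ affineSpan ℝ ((insert p T : Finset E) : Set E) :=
      subset_affineSpan _ _ (by simp)
    have hqS : AffineMap.lineMap p m s ∈ affineSpan ℝ ((insert p T : Finset E) : Set E) :=
      affineSpan_mono ℝ (by simp) (convexHull_subset_affineSpan _ hqT)
    have hm : m = AffineMap.lineMap p (AffineMap.lineMap p m s) s⁻¹ := by
      simp [AffineMap.lineMap_apply, smul_smul, hs0]
    rw [hm]
    exact AffineMap.lineMap_mem _ hpS hqS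
  refine ⟨m, hmV, key b hb hm.2, ?_⟩
  rw [segment_symm]
  exact key a ha hm.1

theorem exists_nhd_fiber_joinedIn (hπ : IsProperMap π) (hconv : ∀ x, Convex ℝ (π ⁻¹' {x}))
    {T : Finset E} (hT : T.card < Module.finrank ℝ E) (x₀ : E)
    {O : Set E} (hO : IsOpen O) (hx₀ : π ⁻¹' {π x₀} ⊆ O) :
    ∃ V : Set E, IsOpen V ∧ π ⁻¹' {π x₀} ⊆ V ∧
      ∀ a ∈ V \ π ⁻¹' (π '' convexHull ℝ (T : Set E)),
      ∀ b ∈ V \ π ⁻¹' (π '' convexHull ℝ (T : Set E)),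
        JoinedIn (O \ π ⁻¹' (π '' convexHull ℝ (T : Set E))) a b := by
  set σ := convexHull ℝ (T : Set E)
  have hσ : IsCompact σ := T.finite_toSet.isCompact_convexHull ℝ
  have hσc : Convex ℝ σ := convex_convexHull ℝ _
  have hBc : IsCompact (π ⁻¹' (π '' σ)) := hπ.isCompact_preimage (hσ.image hπ.continuous)
  obtain ⟨V, W, hV, hVc, hxV, hW, hWO, hVW, hsat⟩ := exists_convex_nhd_fiber hπ hconv x₀ hO hx₀
  refine ⟨V, hV, hxV, fun a ha b hb => ?_⟩
  obtain ⟨r, hr⟩ := hW.isBounded.subset_ball (0 : E)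
  have hσB : σ ⊆ π ⁻¹' (π '' σ) := subset_preimage_image _ _
  obtain ⟨m, hmV, hbm, hma⟩ := exists_segments_disjoint_convexHull hT hV ⟨a, ha.1⟩
    (fun h => ha.2 (hσB h)) (fun h => hb.2 (hσB h))
  have hsbm : segment ℝ b m ⊆ V := hVc.segment_subset hb.1 hmV
  have hsma : segment ℝ m a ⊆ V := hVc.segment_subset hmV ha.1
  have hcseg : ∀ p q : E, IsCompact (segment ℝ p q) := fun p q => by
    rw [segment_eq_image']
    exact isCompact_Icc.image (by fun_prop)
  have hab : ({a, b} : Set E) ⊆ (π ⁻¹' (π '' σ))ᶜ := by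
    rintro x (rfl | rfl)
    · exact ha.2
    · exact hb.2
  obtain ⟨η, hη, hηab⟩ := (Set.toFinite {a, b}).isCompact.exists_thickening_subset_open
    hBc.isClosed.isOpen_compl hab
  have hU : IsOpen (O ∩ ball (0 : E) r) := hO.inter isOpen_ball
  have hWU : W ⊆ O ∩ ball (0 : E) r := subset_inter hWO hr
  obtain ⟨h, hh, hid, hpush⟩ := exists_push hπ hconv hσ hσc ((hcseg b m).union (hcseg m a)) hV
    (union_subset hsbm hsma) hW hsat hU hWU (hbm.union_left hma) hη
  have htrack : ∀ p ∈ ({a, b} : Set E), ∀ x ∈ π ⁻¹' (π '' σ), p ∉ segment ℝ x (h x) := by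
    intro p hp x hx hpx
    obtain ⟨y, hy, hpy⟩ := mem_thickening_iff.1 ((hpush x hx).2 hpx)
    exact hηab (mem_thickening_iff.2 ⟨p, hp, by rwa [dist_comm]⟩) hy
  have := joinedIn_diff_of_push (a := a) (b := b) (m := m) hU (isBounded_ball.subset inter_subset_right) hBc.isClosed
    ⟨hWU (hVW ha.1), ha.2⟩ ⟨hWU (hVW hb.1), hb.2⟩ ((hsbm.trans hVW).trans hWU)
    ((hsma.trans hVW).trans hWU) hh hid (htrack a (by simp)) (htrack b (by simp))
    (fun x hx hx' => (hpush x hx).1 (Or.inl hx')) (fun x hx hx' => (hpush x hx).1 (Or.inr hx'))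
  exact this.mono (sdiff_subset_sdiff_left inter_subset_left)

open MeasureTheory in
theorem interior_image_convexHull_eq_empty (hπ : IsProperMap π) (hsurj : Function.Surjective π)
    (hconv : ∀ x, Convex ℝ (π ⁻¹' {x})) {T : Finset E} (hT : T.card < Module.finrank ℝ E) :
    interior (π '' convexHull ℝ (T : Set E)) = ∅ := by
  set σ := convexHull ℝ (T : Set E)
  have hσ : IsCompact σ := T.finite_toSet.isCompact_convexHull ℝ
  have hσc : Convex ℝ σ := convex_convexHull ℝ _
  have hBc : IsCompact (π ⁻¹' (π '' σ)) := hπ.isCompact_preimage (hσ.image hπ.continuous)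
  by_contra hne
  obtain ⟨p, hp⟩ := nonempty_iff_ne_empty.2 hne
  obtain ⟨x₀, rfl⟩ := hsurj p
  set O := π ⁻¹' interior (π '' σ)
  have hO : IsOpen O := isOpen_interior.preimage hπ.continuous
  have hOB : O ⊆ π ⁻¹' (π '' σ) := preimage_mono interior_subset
  obtain ⟨V, W, hV, hVc, hxV, hW, hWO, hVW, hsat⟩ := exists_convex_nhd_fiber hπ hconv x₀ hO
    (fun y hy => by
      have hy : π y = π x₀ := hy
      change π y ∈ interior (π '' σ)
      rwa [hy])
  borelize E
  obtain ⟨a, haV, haσ⟩ : ∃ a ∈ V, a ∉ σ := by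
    by_contra! hsub
    refine (hV.measure_pos volume ⟨x₀, hxV rfl⟩).ne' (measure_mono_null (fun x hx => ?_)
      (measure_convexHull_eq_zero volume hT.le))
    exact convexHull_subset_affineSpan _ (hsub x hx)
  obtain ⟨h, hh, hid, hpush⟩ := exists_push hπ hconv hσ hσc (isCompact_singleton (x := a)) hV
    (singleton_subset_iff.2 haV) hW hsat hO hWO (Set.disjoint_singleton_left.2 haσ) one_pos
  obtain ⟨r, hr⟩ := hBc.isBounded.subset_ball (0 : E)
  have hout : ∀ x, r ≤ ‖x‖ → h x = x := fun x hx => hid x fun hxO => by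
    have := hr (hOB hxO)
    simp at this
    linarith
  obtain ⟨x, hx⟩ := surjective_of_continuous_of_eq_id_of_le_norm hh hout a
  by_cases hxO : x ∈ O
  · exact (hpush x (hOB hxO)).1 hx
  · rw [hid x hxO] at hx
    exact hxO (hWO (hVW (hx ▸ haV)))

end Push

section Paths

variable {X : Type*} [MetricSpace X]

/-- A sequence of points outside `P` whose consecutive terms are joined outside `P` and close to
`α` can be traced by a path outside `P` close to `α`. -/
theorem exists_continuous_of_joinedIn {P : Set X} {α : ℝ → X} {ε : ℝ} {N : ℕ} (hN : 0 < N)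
    {q : ℕ → X} (hq : ∀ k, ∃ W : Set X, JoinedIn (W \ P) (q k) (q (k + 1)) ∧
      ∀ x ∈ W, ∀ t ∈ Icc ((k : ℝ) / N) ((k + 1 : ℝ) / N), dist x (α t) < ε) (k : ℕ) :
    ∃ β : ℝ → X, Continuous β ∧ (∀ t, β t ∉ P) ∧ (∀ t, (k : ℝ) / N ≤ t → β t = q k) ∧
      ∀ t ∈ Icc (0 : ℝ) ((k : ℝ) / N), dist (β t) (α t) < ε := by
  have hN' : (0 : ℝ) < N := by exact_mod_cast hN
  induction k with
  | zero =>
    obtain ⟨W, hW, hd⟩ := hq 0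
    refine ⟨fun _ ↦ q 0, continuous_const, fun _ ↦ hW.source_mem.2, fun _ _ ↦ rfl, ?_⟩
    intro t ht
    refine hd _ hW.source_mem.1 t ⟨by simpa using ht.1, ?_⟩
    have : t ≤ 0 := by simpa using ht.2
    exact this.trans (by positivity)
  | succ k ih =>
    obtain ⟨β, hβ, hβP, hβq, hβd⟩ := ih
    obtain ⟨W, ⟨γ, hγ⟩, hd⟩ := hq k
    have hγ' : ∀ s, γ.extend s ∈ W \ P := by
      intro s
      have : γ.extend s ∈ range γ.extend := mem_range_self s
      rw [Path.extend_range] at this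
      obtain ⟨u, hu⟩ := this
      exact hu ▸ hγ u
    refine ⟨fun s ↦ if s ≤ (k : ℝ) / N then β s else γ.extend (N * s - k), ?_, ?_, ?_, ?_⟩
    · refine Continuous.if_le hβ (by fun_prop) continuous_id continuous_const ?_
      rintro s rfl
      rw [hβq _ le_rfl, mul_div_cancel₀ _ hN'.ne', sub_self, Path.extend_zero]
    · intro t
      by_cases h : t ≤ (k : ℝ) / N
      · simpa [h] using hβP t
      · simpa [h] using (hγ' _).2
    · intro t ht
      have h1 : (k + 1 : ℝ) ≤ N * t := by
        rw [div_le_iff₀ hN'] at ht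
        push_cast at ht
        linarith
      have h : ¬ t ≤ (k : ℝ) / N := by
        rw [le_div_iff₀ hN']
        linarith
      simp only [h, if_false]
      exact Path.extend_of_one_le _ (by linarith)
    · intro t ht
      by_cases h : t ≤ (k : ℝ) / N
      · simpa [h] using hβd t ⟨ht.1, h⟩
      · simp only [h, if_false]
        exact hd _ (hγ' _).1 t ⟨(not_le.1 h).le, by simpa using ht.2⟩

/-- Paths can be pushed off a locally non-separating set with empty interior. -/
theorem exists_path_dist_lt_forall_notMem {P : Set X} (hP : interior P = ∅)
    (hsep : ∀ p, ∀ U : Set X, IsOpen U → p ∈ U →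
      ∃ V, IsOpen V ∧ p ∈ V ∧ ∀ a ∈ V \ P, ∀ b ∈ V \ P, JoinedIn (U \ P) a b)
    (α : C(unitInterval, X)) {ε : ℝ} (hε : 0 < ε) :
    ∃ β : C(unitInterval, X), (∀ t, dist (β t) (α t) < ε) ∧ ∀ t, β t ∉ P := by
  choose V hVo hpV hVj using fun p : X ↦ hsep p (ball p (ε / 2)) isOpen_ball
    (mem_ball_self (half_pos hε))
  obtain ⟨δ, hδ, hδc⟩ := lebesgue_number_lemma_of_metric (s := range α)
    (c := fun p ↦ V p ∩ ball p (ε / 2)) (isCompact_range α.continuous)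
    (fun p ↦ (hVo p).inter isOpen_ball)
    (fun x _ ↦ mem_iUnion.2 ⟨x, hpV x, mem_ball_self (half_pos hε)⟩)
  set a : ℝ → X := IccExtend zero_le_one α with ha
  have har : ∀ t, a t ∈ range α := fun t ↦ mem_range_self _
  have hau : UniformContinuous a :=
    (CompactSpace.uniformContinuous_of_continuous α.continuous).comp
      (LipschitzWith.projIcc zero_le_one).uniformContinuous
  obtain ⟨η, hη, hηa⟩ := Metric.uniformContinuous_iff.1 hau δ hδ
  obtain ⟨M, hM⟩ := exists_nat_one_div_lt hη
  set N : ℕ := M + 1 with hNdef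
  have hN' : (0 : ℝ) < N := by positivity
  have hMN : 1 / (N : ℝ) < η := by simpa [hNdef] using hM
  choose p hp using fun k : ℕ ↦ hδc (a ((k : ℝ) / N)) (har _)
  have hnear : ∀ (k : ℕ), ∀ t ∈ Icc ((k : ℝ) / N) ((k + 1 : ℝ) / N),
      a t ∈ V (p k) ∩ ball (p k) (ε / 2) := by
    intro k t ht
    refine hp k (hηa ?_)
    rw [Real.dist_eq, abs_of_nonneg (by linarith [ht.1])]
    have := ht.2
    rw [add_div] at this
    linarith
  have hq : ∀ k : ℕ, ∃ q, q ∉ P ∧ q ∈ V (p k) ∧ q ∈ V (p (k - 1)) := by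
    intro k
    have h1 : a ((k : ℝ) / N) ∈ V (p k) ∩ V (p (k - 1)) := by
      refine ⟨(hnear k _ ⟨le_rfl, by gcongr; linarith⟩).1, ?_⟩
      cases k with
      | zero => exact (hnear 0 _ ⟨le_rfl, by gcongr; simp⟩).1
      | succ k => exact (hnear k _ ⟨by gcongr; simp, by simp⟩).1
    by_contra! hcon
    have : V (p k) ∩ V (p (k - 1)) ⊆ interior P := by
      refine interior_maximal (fun x hx ↦ ?_) ((hVo _).inter (hVo _))
      by_contra hxP
      exact hcon x hxP hx.1 hx.2
    rw [hP] at this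
    exact this h1
  choose q hqP hq1 hq2 using hq
  obtain ⟨β, hβ, hβP, -, hβd⟩ := exists_continuous_of_joinedIn (P := P) (α := a) (ε := ε)
    (N := N) (Nat.succ_pos M) (q := q) (fun k ↦ ⟨ball (p k) (ε / 2),
      hVj (p k) _ ⟨hq1 k, hqP k⟩ _ ⟨hq2 (k + 1), hqP (k + 1)⟩, fun x hx t ht ↦ by
        have h1 := (hnear k t ht).2
        rw [mem_ball] at hx h1
        linarith [dist_triangle_right x (a t) (p k)]⟩) N
  refine ⟨⟨fun t ↦ β t, by fun_prop⟩, fun t ↦ ?_, fun t ↦ hβP t⟩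
  have := hβd t ⟨t.2.1, by rw [div_self hN'.ne']; exact t.2.2⟩
  simpa [ha, IccExtend_val] using this

end Paths

section PathsQuotient

variable {E X : Type*} [NormedAddCommGroup E] [InnerProductSpace ℝ E] [FiniteDimensional ℝ E]
  [MetricSpace X] {π : E → X}

/-- Paths in the target of a proper surjection with convex fibres can be pushed off the images of
finitely many simplices of positive codimension. -/
theorem exists_path_dist_lt_forall_notMem_image (hπ : IsProperMap π)
    (hsurj : Function.Surjective π) (hconv : ∀ x, Convex ℝ (π ⁻¹' {x})) (𝒯 : Finset (Finset E))
    (h𝒯 : ∀ T ∈ 𝒯, T.card < Module.finrank ℝ E) (α : C(unitInterval, X)) {ε : ℝ} (hε : 0 < ε) :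
    ∃ β : C(unitInterval, X), dist β α < ε ∧
      ∀ t, ∀ T ∈ 𝒯, β t ∉ π '' convexHull ℝ (T : Set E) := by
  have hclosed : ∀ T : Finset E, IsClosed (π '' convexHull ℝ (T : Set E)) := fun T ↦
    hπ.isClosedMap _ (T.finite_toSet.isCompact_convexHull (𝕜 := ℝ)).isClosed
  have hopen : ∀ T : Finset E, IsOpen {β : C(unitInterval, X) |
      MapsTo β univ (π '' convexHull ℝ (T : Set E))ᶜ} := fun T ↦
    ContinuousMap.isOpen_setOfPred_mapsTo isCompact_univ (hclosed T).isOpen_compl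
  have hdense : ∀ T : Finset E, T.card < Module.finrank ℝ E → Dense {β : C(unitInterval, X) |
      MapsTo β univ (π '' convexHull ℝ (T : Set E))ᶜ} := by
    intro T hT
    rw [Metric.dense_iff]
    intro α ε hε
    obtain ⟨β, hβα, hβ⟩ := exists_path_dist_lt_forall_notMem
      (interior_image_convexHull_eq_empty hπ hsurj hconv hT) (fun p U hU hp ↦ by
        obtain ⟨x₀, rfl⟩ := hsurj p
        obtain ⟨V, hV, hxV, hVj⟩ := exists_nhd_fiber_joinedIn hπ hconv hT x₀
          (hU.preimage hπ.continuous) (fun x hx ↦ by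
            rw [mem_preimage, mem_singleton_iff.1 hx]
            exact hp)
        refine ⟨(π '' Vᶜ)ᶜ, (hπ.isClosedMap _ hV.isClosed_compl).isOpen_compl, ?_, ?_⟩
        · rintro ⟨x, hx, hxx⟩
          exact hx (hxV hxx)
        · intro a ha b hb
          obtain ⟨a, rfl⟩ := hsurj a
          obtain ⟨b, rfl⟩ := hsurj b
          have key : ∀ c, π c ∈ (π '' Vᶜ)ᶜ \ π '' convexHull ℝ (T : Set E) →
              c ∈ V \ π ⁻¹' (π '' convexHull ℝ (T : Set E)) := fun c hc ↦
            ⟨by_contra fun h ↦ hc.1 ⟨c, h, rfl⟩, hc.2⟩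
          obtain ⟨γ, hγ⟩ := hVj a (key a ha) b (key b hb)
          exact ⟨γ.map hπ.continuous, fun t ↦ hγ t⟩) α hε
    refine ⟨β, ?_, fun t _ ↦ hβ t⟩
    rw [mem_ball, ContinuousMap.dist_lt_iff hε]
    exact hβα
  have hall : IsOpen {β : C(unitInterval, X) | ∀ T ∈ 𝒯,
      MapsTo β univ (π '' convexHull ℝ (T : Set E))ᶜ} ∧ Dense {β : C(unitInterval, X) | ∀ T ∈ 𝒯,
      MapsTo β univ (π '' convexHull ℝ (T : Set E))ᶜ} := by
    classical
    induction 𝒯 using Finset.induction_on with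
    | empty => simp
    | insert T 𝒯 _ ih =>
      have := ih fun T' hT' ↦ h𝒯 T' (Finset.mem_insert_of_mem hT')
      simp only [Finset.forall_mem_insert]
      exact ⟨(hopen T).inter this.1, (hdense T (h𝒯 T (Finset.mem_insert_self _ _))).inter_of_isOpen_left
        this.2 (hopen T)⟩
  obtain ⟨β, hβα, hβ⟩ := Metric.dense_iff.1 hall.2 α ε hε
  exact ⟨β, hβα, fun t T hT ↦ hβ T hT (mem_univ t)⟩

end PathsQuotient

section PiecewiseLinear

/-- The piecewise linear bump function of a vertex of the standard triangulation of the plane with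
vertex set `ℤ²`. -/
def planarHat (u v : ℝ) : ℝ := max 0 (1 - max |u| (max |v| |u - v|))

theorem planarHat_nonneg (u v : ℝ) : 0 ≤ planarHat u v := le_max_left _ _

theorem planarHat_ne_zero_iff {u v : ℝ} :
    planarHat u v ≠ 0 ↔ |u| < 1 ∧ |v| < 1 ∧ |u - v| < 1 := by
  rw [← (planarHat_nonneg u v).lt_iff_ne']
  simp [planarHat]

theorem planarHat_fract_ne_zero (u v : ℝ) : planarHat (u - ⌊u⌋) (v - ⌊v⌋) ≠ 0 := by
  rw [planarHat_ne_zero_iff]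
  have h1 := Int.floor_le u
  have h2 := Int.lt_floor_add_one u
  have h3 := Int.floor_le v
  have h4 := Int.lt_floor_add_one v
  refine ⟨?_, ?_, ?_⟩ <;> rw [abs_lt] <;> constructor <;> linarith

theorem card_filter_planarHat_ne_zero_le (s : Finset (ℤ × ℤ)) (u v : ℝ) :
    (s.filter fun i ↦ planarHat (u - i.1) (v - i.2) ≠ 0).card ≤ 3 := by
  have h1 := Int.floor_le u
  have h2 := Int.lt_floor_add_one u
  have h3 := Int.floor_le v
  have h4 := Int.lt_floor_add_one v
  set a := ⌊u⌋
  set b := ⌊v⌋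
  have key : ∀ i : ℤ × ℤ, planarHat (u - i.1) (v - i.2) ≠ 0 →
      i = (a, b) ∨ i = (a + 1, b + 1) ∨ (i = (a + 1, b) ∧ v - b < u - a) ∨
        (i = (a, b + 1) ∧ u - a < v - b) := by
    rintro ⟨i, j⟩ hi
    rw [planarHat_ne_zero_iff, abs_lt, abs_lt, abs_lt] at hi
    obtain ⟨⟨hi1, hi2⟩, ⟨hj1, hj2⟩, hd1, hd2⟩ := hi
    simp only at hi1 hi2 hj1 hj2 hd1 hd2
    have e1 : a - 1 < i := by
      have : (a : ℝ) - 1 < i := by linarith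
      exact_mod_cast this
    have e2 : i < a + 2 := by
      have : (i : ℝ) < a + 2 := by linarith
      exact_mod_cast this
    have e3 : b - 1 < j := by
      have : (b : ℝ) - 1 < j := by linarith
      exact_mod_cast this
    have e4 : j < b + 2 := by
      have : (j : ℝ) < b + 2 := by linarith
      exact_mod_cast this
    obtain rfl | rfl : i = a ∨ i = a + 1 := by omega
    · obtain rfl | rfl : j = b ∨ j = b + 1 := by omega
      · exact Or.inl rfl
      · push_cast at hd1 hd2
        exact Or.inr (Or.inr (Or.inr ⟨rfl, by linarith⟩))
    · obtain rfl | rfl : j = b ∨ j = b + 1 := by omega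
      · push_cast at hd1 hd2
        exact Or.inr (Or.inr (Or.inl ⟨rfl, by linarith⟩))
      · exact Or.inr (Or.inl rfl)
  by_cases hle : v - b < u - a
  · refine (Finset.card_le_card (t := {(a, b), (a + 1, b + 1), (a + 1, b)}) fun i hi ↦ ?_).trans
      Finset.card_le_three
    rcases key i (Finset.mem_filter.1 hi).2 with h | h | h | h
    · simp [h]
    · simp [h]
    · simp [h.1]
    · exact absurd hle h.2.le.not_gt
  · refine (Finset.card_le_card (t := {(a, b), (a + 1, b + 1), (a, b + 1)}) fun i hi ↦ ?_).trans
      Finset.card_le_three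
    rcases key i (Finset.mem_filter.1 hi).2 with h | h | h | h
    · simp [h]
    · simp [h]
    · exact absurd h.2 hle
    · simp [h.1]

/-- Every map from the unit disk, continuous or not, admits a continuous local averaging whose
values lie in finitely many simplices of dimension at most two. -/
theorem exists_continuous_mem_convexHull_image_ball {E : Type*} [NormedAddCommGroup E]
    [NormedSpace ℝ E] (l : closedBall (0 : EuclideanSpace ℝ (Fin 2)) 1 → E) {δ : ℝ} (hδ : 0 < δ) :
    ∃ (g : closedBall (0 : EuclideanSpace ℝ (Fin 2)) 1 → E) (𝒯 : Finset (Finset E)),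
      Continuous g ∧ (∀ T ∈ 𝒯, T.card ≤ 3) ∧
        ∀ z, ∃ T ∈ 𝒯, g z ∈ convexHull ℝ (T : Set E) ∧ (T : Set E) ⊆ l '' ball z δ := by
  classical
  obtain ⟨k, hk⟩ := exists_nat_one_div_lt (show 0 < δ / 4 by positivity)
  set m : ℝ := k + 1 with hm
  have hm0 : 0 < m := by positivity
  have hmδ : 4 / m < δ := by
    rw [div_lt_iff₀ hm0] at hk ⊢
    linarith
  set M : ℤ := k + 1 with hM
  have hMm : (M : ℝ) = m := by simp [hM, hm]
  set s : Finset (ℤ × ℤ) := Finset.Icc (-M) M ×ˢ Finset.Icc (-M) M with hs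
  set W : closedBall (0 : EuclideanSpace ℝ (Fin 2)) 1 → ℤ × ℤ → ℝ := fun z i ↦
    planarHat (m * z.1 0 - i.1) (m * z.1 1 - i.2) with hW
  have hWc : ∀ i, Continuous fun z ↦ W z i := fun i ↦ by
    simp only [hW, planarHat]
    fun_prop
  have hW0 : ∀ z i, 0 ≤ W z i := fun z i ↦ planarHat_nonneg _ _
  have hWpos : ∀ z, 0 < ∑ i ∈ s, W z i := by
    intro z
    have hz : ∀ j, ⌊m * z.1 j⌋ ∈ Finset.Icc (-M) M := by
      intro j
      have h1 : |z.1 j| ≤ 1 := by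
        exact (PiLp.norm_apply_le z.1 j).trans (mem_closedBall_zero_iff.1 z.2)
      obtain ⟨h2, h3⟩ := abs_le.1 h1
      rw [Finset.mem_Icc]
      constructor
      · rw [Int.le_floor]
        push_cast
        rw [hMm]
        nlinarith
      · have : (⌊m * z.1 j⌋ : ℝ) ≤ M := (Int.floor_le _).trans (by rw [hMm]; nlinarith)
        exact_mod_cast this
    refine Finset.sum_pos' (fun i _ ↦ hW0 z i) ⟨(⌊m * z.1 0⌋, ⌊m * z.1 1⌋),
      Finset.mem_product.2 ⟨hz 0, hz 1⟩, (hW0 _ _).lt_of_ne' ?_⟩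
    exact planarHat_fract_ne_zero _ _
  have hp : ∀ i, ∃ w, ∀ z, W z i ≠ 0 → W w i ≠ 0 := by
    intro i
    by_cases h : ∃ w, W w i ≠ 0
    · exact h.imp fun w hw _ _ ↦ hw
    · push Not at h
      exact ⟨⟨0, by simp⟩, fun z hz ↦ absurd (h z) hz⟩
  choose p hp using hp
  have hpd : ∀ z i, W z i ≠ 0 → dist (p i) z < δ := by
    intro z i hz
    have hw := hp i z hz
    rw [hW, planarHat_ne_zero_iff, abs_lt, abs_lt] at hz hw
    have hcoord : ∀ x y c : ℝ, -1 < m * x - c ∧ m * x - c < 1 → -1 < m * y - c ∧ m * y - c < 1 →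
        dist x y ^ 2 ≤ (2 / m) ^ 2 := by
      intro x y c hx hy
      have : |x - y| ≤ 2 / m := by
        rw [abs_le, neg_le, le_div_iff₀ hm0, le_div_iff₀ hm0]
        constructor <;> linarith [hx.1, hx.2, hy.1, hy.2]
      rw [Real.dist_eq]
      gcongr
    refine lt_of_le_of_lt ?_ hmδ
    rw [Subtype.dist_eq, EuclideanSpace.dist_eq, Fin.sum_univ_two]
    refine Real.sqrt_le_iff.2 ⟨by positivity, ?_⟩
    have h1 := hcoord _ _ _ hw.1 hz.1
    have h2 := hcoord _ _ _ hw.2.1 hz.2.1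
    have h3 : (4 / m) ^ 2 = 4 * (2 / m) ^ 2 := by ring
    nlinarith [sq_nonneg (2 / m)]
  refine ⟨fun z ↦ s.centerMass (W z) (fun i ↦ l (p i)),
    (s.powerset.image fun A ↦ A.image fun i ↦ l (p i)).filter fun T ↦ T.card ≤ 3, ?_,
    fun T hT ↦ (Finset.mem_filter.1 hT).2, fun z ↦
    ⟨(s.filter fun i ↦ W z i ≠ 0).image fun i ↦ l (p i), ?_, ?_, ?_⟩⟩
  · simp only [Finset.centerMass]
    refine Continuous.smul (Continuous.inv₀ (continuous_finsetSum _ fun i _ ↦ hWc i)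
      fun z ↦ (hWpos z).ne') (continuous_finsetSum _ fun i _ ↦ (hWc i).smul continuous_const)
  · refine Finset.mem_filter.2 ⟨Finset.mem_image_of_mem _ (Finset.mem_powerset.2
      (Finset.filter_subset _ _)), Finset.card_image_le.trans ?_⟩
    exact card_filter_planarHat_ne_zero_le s _ _
  · beta_reduce
    rw [← Finset.centerMass_filter_ne_zero]
    refine Finset.centerMass_mem_convexHull _ (fun i _ ↦ hW0 z i) ?_ fun i hi ↦
      Finset.mem_coe.2 (Finset.mem_image_of_mem _ hi)
    rw [Finset.sum_filter_ne_zero]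
    exact hWpos z
  · intro x hx
    obtain ⟨i, hi, rfl⟩ := Finset.mem_image.1 (Finset.mem_coe.1 hx)
    exact ⟨p i, hpd z i (Finset.mem_filter.1 hi).2, rfl⟩

end PiecewiseLinear

section Disks

variable {E X : Type*} [NormedAddCommGroup E] [InnerProductSpace ℝ E] [MetricSpace X] {π : E → X}

/-- Disks in the target of a proper surjection with convex fibres can be approximated by disks in
the image of finitely many simplices of dimension at most two. -/
theorem exists_disk_dist_lt_forall_mem_image (hπ : IsProperMap π)
    (hsurj : Function.Surjective π) (hconv : ∀ x, Convex ℝ (π ⁻¹' {x}))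
    (f : C(closedBall (0 : EuclideanSpace ℝ (Fin 2)) 1, X)) {ε : ℝ} (hε : 0 < ε) :
    ∃ (f' : C(closedBall (0 : EuclideanSpace ℝ (Fin 2)) 1, X)) (𝒯 : Finset (Finset E)),
      dist f' f < ε ∧ (∀ T ∈ 𝒯, T.card ≤ 3) ∧
        ∀ z, ∃ T ∈ 𝒯, f' z ∈ π '' convexHull ℝ (T : Set E) := by
  have hr : ∀ p, ∃ r, 0 < r ∧ thickening r (π ⁻¹' {p}) ⊆ π ⁻¹' ball p (ε / 2) := fun p ↦
    (hπ.isCompact_preimage isCompact_singleton).exists_thickening_subset_open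
      (isOpen_ball.preimage hπ.continuous) (preimage_mono (by simpa using hε))
  choose r hr hrb using hr
  obtain ⟨δ, hδ, hδc⟩ := lebesgue_number_lemma_of_metric
    (s := (univ : Set (closedBall (0 : EuclideanSpace ℝ (Fin 2)) 1)))
    (c := fun p ↦ f ⁻¹' (π '' (thickening (r p) (π ⁻¹' {p}))ᶜ)ᶜ) isCompact_univ
    (fun p ↦ (hπ.isClosedMap _ isOpen_thickening.isClosed_compl).isOpen_compl.preimage f.continuous)
    (fun z _ ↦ mem_iUnion.2 ⟨f z, by
      rintro ⟨x, hx, hxz⟩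
      exact hx (self_subset_thickening (hr _) _ hxz)⟩)
  choose l hl using fun z ↦ hsurj (f z)
  obtain ⟨g, 𝒯, hg, h𝒯, hgT⟩ := exists_continuous_mem_convexHull_image_ball l hδ
  refine ⟨⟨fun z ↦ π (g z), hπ.continuous.comp hg⟩, 𝒯, ?_, h𝒯, fun z ↦ ?_⟩
  · rw [ContinuousMap.dist_lt_iff hε]
    intro z
    obtain ⟨p, hp⟩ := hδc z (mem_univ z)
    have hlp : ∀ w ∈ ball z δ, l w ∈ thickening (r p) (π ⁻¹' {p}) := fun w hw ↦
      by_contra fun h ↦ hp hw ⟨l w, h, hl w⟩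
    obtain ⟨T, -, hgz, hT⟩ := hgT z
    have h1 : π (g z) ∈ ball p (ε / 2) := by
      refine hrb p (convexHull_min (hT.trans ?_) ((hconv p).thickening _) hgz)
      rintro _ ⟨w, hw, rfl⟩
      exact hlp w hw
    have h2 : f z ∈ ball p (ε / 2) := hl z ▸ hrb p (hlp z (mem_ball_self hδ))
    rw [mem_ball] at h1 h2
    have := dist_triangle_right (π (g z)) (f z) p
    change dist (π (g z)) (f z) < ε
    linarith
  · obtain ⟨T, hT, hgz, -⟩ := hgT z
    exact ⟨T, hT, g z, hgz, rfl⟩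

end Disks

section Metrizable

/-- The image of a second countable normal space under a proper map is metrizable. -/
theorem IsProperMap.metrizableSpace {E X : Type*} [TopologicalSpace E] [TopologicalSpace X]
    [T4Space E] [SecondCountableTopology E] {π : E → X} (hπ : IsProperMap π)
    (hsurj : Function.Surjective π) : TopologicalSpace.MetrizableSpace X := by
  have hopen : ∀ V : Set E, IsOpen V → IsOpen (π '' Vᶜ)ᶜ := fun V hV ↦
    (hπ.isClosedMap _ hV.isClosed_compl).isOpen_compl
  have hmem : ∀ (V : Set E) p, p ∈ (π '' Vᶜ)ᶜ ↔ π ⁻¹' {p} ⊆ V := by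
    intro V p
    simp only [mem_compl_iff, mem_image, not_exists, not_and, subset_def, mem_preimage,
      mem_singleton_iff]
    exact forall_congr' fun x ↦ ⟨fun h hx ↦ by_contra fun h' ↦ h h' hx, fun h hx hx' ↦ hx (h hx')⟩
  have hT1 : T1Space X := ⟨fun p ↦ by
    obtain ⟨x, rfl⟩ := hsurj p
    simpa using hπ.isClosedMap {x} isClosed_singleton⟩
  have hnormal : NormalSpace X := ⟨fun A B hA hB hAB ↦ by
    obtain ⟨U, V, hU, hV, hAU, hBV, hUV⟩ := NormalSpace.normal (π ⁻¹' A) (π ⁻¹' B)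
      (hA.preimage hπ.continuous) (hB.preimage hπ.continuous) (hAB.preimage π)
    refine ⟨_, _, hopen U hU, hopen V hV, fun p hp ↦ (hmem U p).2 ?_, fun p hp ↦ (hmem V p).2 ?_,
      Set.disjoint_left.2 fun p hpU hpV ↦ ?_⟩
    · exact (preimage_mono (singleton_subset_iff.2 hp)).trans hAU
    · exact (preimage_mono (singleton_subset_iff.2 hp)).trans hBV
    · obtain ⟨x, rfl⟩ := hsurj p
      exact Set.disjoint_left.1 hUV ((hmem U _).1 hpU rfl) ((hmem V _).1 hpV rfl)⟩
  have hsecond : SecondCountableTopology X := by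
    set b := TopologicalSpace.countableBasis E
    have hb := TopologicalSpace.isBasis_countableBasis E
    have hc : {F : Set (Set E) | F.Finite ∧ F ⊆ b}.Countable :=
      Set.countable_ofPred_finite_subset (TopologicalSpace.countable_countableBasis E)
    refine TopologicalSpace.IsTopologicalBasis.secondCountableTopology
      (b := (fun F : Set (Set E) ↦ (π '' (⋃₀ F)ᶜ)ᶜ) '' {F | F.Finite ∧ F ⊆ b}) ?_ (hc.image _)
    refine TopologicalSpace.isTopologicalBasis_of_isOpen_of_nhds ?_ fun p U hp hU ↦ ?_
    · rintro _ ⟨F, hF, rfl⟩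
      exact hopen _ (isOpen_sUnion fun u hu ↦ hb.isOpen (hF.2 hu))
    · have hK := hπ.isCompact_preimage (isCompact_singleton (x := p))
      obtain ⟨F, hF, hFfin, hpF⟩ := hK.elim_finite_subcover_image (b := {u ∈ b | u ⊆ π ⁻¹' U})
        (c := id) (fun u hu ↦ hb.isOpen hu.1) (fun x hx ↦ by
          obtain ⟨u, hu, hxu, huU⟩ := hb.exists_subset_of_mem_open
            (show x ∈ π ⁻¹' U by rw [mem_preimage, mem_singleton_iff.1 hx]; exact hp)
            (hU.preimage hπ.continuous)
          exact mem_biUnion (show u ∈ {u ∈ b | u ⊆ π ⁻¹' U} from ⟨hu, huU⟩) hxu)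
      simp only [id, ← sUnion_eq_biUnion] at hpF
      refine ⟨_, ⟨F, ⟨hFfin, fun u hu ↦ (hF hu).1⟩, rfl⟩, (hmem _ p).2 hpF, fun q hq ↦ ?_⟩
      obtain ⟨x, rfl⟩ := hsurj q
      obtain ⟨u, hu, hxu⟩ := (hmem _ _).1 hq rfl
      exact (hF hu).2 hxu
  exact TopologicalSpace.metrizableSpace_of_t3_secondCountable X

end Metrizable

end

/-- If `G` is an upper semicontinuous decomposition of `ℝⁿ`, `n ≥ 4`, into
compact convex sets, then `X = ℝⁿ/G` has the disjoint arc-disk property: the set of pairs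
`(α, f) ∈ C(I, X) × C(D², X)` with `α(I) ∩ f(D²) = ∅` is dense in `C(I, X) × C(D², X)`
(compact-open topology). -/
theorem convex_decomposition_DADP
    (n : ℕ) (hn : 4 ≤ n) (S : Setoid (EuclideanSpace ℝ (Fin n)))
    (hcompact : ∀ x, IsCompact {y | S x y})
    (hconvex : ∀ x, Convex ℝ {y | S x y})
    (hproper : IsProperMap (Quotient.mk S)) :
    Dense {p : C(unitInterval, Quotient S) ×
        C((Metric.closedBall (0 : EuclideanSpace ℝ (Fin 2)) 1 : Set (EuclideanSpace ℝ (Fin 2))),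
          Quotient S) |
      Set.range p.1 ∩ Set.range p.2 = ∅} := by
  have hsurj : Function.Surjective (Quotient.mk S) := Quotient.mk_surjective
  have hconv : ∀ p, Convex ℝ (Quotient.mk S ⁻¹' {p}) := by
    intro p
    obtain ⟨x, rfl⟩ := hsurj p
    convert hconvex x using 1
    ext y
    simp only [Set.mem_preimage, Set.mem_singleton_iff, Set.mem_ofPred_eq]
    exact Quotient.eq.trans ⟨fun h ↦ S.symm h, fun h ↦ S.symm h⟩
  have := hproper.metrizableSpace hsurj
  let _ : MetricSpace (Quotient S) := TopologicalSpace.metrizableSpaceMetric _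
  rw [Metric.dense_iff]
  rintro ⟨α, f⟩ ε hε
  obtain ⟨f', 𝒯, hf', h𝒯, hf𝒯⟩ := exists_disk_dist_lt_forall_mem_image hproper hsurj hconv f hε
  obtain ⟨α', hα', hα𝒯⟩ := exists_path_dist_lt_forall_notMem_image hproper hsurj hconv 𝒯
    (fun T hT ↦ by
      rw [finrank_euclideanSpace_fin]
      exact (h𝒯 T hT).trans_lt (by omega)) α hε
  refine ⟨(α', f'), max_lt hα' hf', Set.eq_empty_iff_forall_notMem.2 ?_⟩
  rintro _ ⟨⟨t, rfl⟩, z, hz⟩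
  obtain ⟨T, hT, hzT⟩ := hf𝒯 z
  exact hα𝒯 t T hT (hz ▸ hzT)
end

section
/- Let n ≥ 2 and let G be an upper semicontinuous decomposition of ℝⁿ into compact convex sets, with quotient map π : ℝⁿ → ℝⁿ/G. Then the set of continuous maps f' : D² → ℝⁿ/G whose image f'(D²) is a finite union of subsets of ℝⁿ/G, each of which admits a topological embedding into ℝ², is dense in C(D², ℝⁿ/G) with the compact-open topology. -/
open Set Topology TopologicalSpace in
/-- A closed continuous surjection from a normal space has a normal target. -/
theorem IsClosedMap.normalSpace_of_surjective {X Y : Type*} [TopologicalSpace X]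
    [TopologicalSpace Y] [NormalSpace X] {f : X → Y} (hf : IsClosedMap f) (hc : Continuous f)
    (hs : Function.Surjective f) : NormalSpace Y := by
  refine ⟨fun A B hA hB hAB => ?_⟩
  obtain ⟨U, V, hU, hV, hAU, hBV, hUV⟩ := NormalSpace.normal (f ⁻¹' A) (f ⁻¹' B)
    (hA.preimage hc) (hB.preimage hc) (hAB.preimage f)
  refine ⟨kernImage f U, kernImage f V, isClosedMap_iff_kernImage.1 hf hU,
    isClosedMap_iff_kernImage.1 hf hV, subset_kernImage_iff.2 hAU, subset_kernImage_iff.2 hBV,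
    Set.disjoint_left.2 fun y hyU hyV => ?_⟩
  obtain ⟨x, rfl⟩ := hs y
  exact Set.disjoint_left.1 hUV (hyU rfl) (hyV rfl)

open Set Topology TopologicalSpace in
/-- A proper surjection from a second countable space has a second countable target. -/
theorem IsProperMap.secondCountableTopology_of_surjective {X Y : Type*} [TopologicalSpace X]
    [TopologicalSpace Y] [SecondCountableTopology X] {f : X → Y} (hf : IsProperMap f)
    (hs : Function.Surjective f) : SecondCountableTopology Y := by
  let b := countableBasis X
  let B : Set (Set Y) := (fun s : Set (Set X) => kernImage f (⋃₀ s)) '' {s | s.Finite ∧ s ⊆ b}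
  have hB : IsTopologicalBasis B := by
    refine isTopologicalBasis_of_isOpen_of_nhds ?_ ?_
    · rintro _ ⟨s, ⟨-, hs⟩, rfl⟩
      exact isClosedMap_iff_kernImage.1 hf.isClosedMap
        (isOpen_sUnion fun t ht => isOpen_of_mem_countableBasis (hs ht))
    · intro y V hy hV
      have hK : IsCompact (f ⁻¹' {y}) := hf.isCompact_preimage isCompact_singleton
      have hKV : f ⁻¹' {y} ⊆ f ⁻¹' V := preimage_mono (singleton_subset_iff.2 hy)
      obtain ⟨s, hsb, hsf, hKs⟩ := hK.elim_finite_subcover_image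
        (b := {t ∈ b | t ⊆ f ⁻¹' V}) (c := id)
        (fun t ht => isOpen_of_mem_countableBasis ht.1) (fun x hx => by
          obtain ⟨t, ht, hxt, htV⟩ := (isBasis_countableBasis X).exists_subset_of_mem_open
            (hKV hx) (hV.preimage hf.continuous)
          exact mem_biUnion (show t ∈ {t ∈ b | t ⊆ f ⁻¹' V} from ⟨ht, htV⟩) hxt)
      refine ⟨_, ⟨s, ⟨hsf, fun t ht => (hsb ht).1⟩, rfl⟩, ?_, ?_⟩
      · intro x hx
        simpa [mem_sUnion] using hKs hx
      · intro z hz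
        obtain ⟨x, rfl⟩ := hs z
        obtain ⟨t, ht, hxt⟩ := hz rfl
        exact (hsb ht).2 hxt
  exact hB.secondCountableTopology
    ((countable_ofPred_finite_subset (countable_countableBasis X)).image _)

/-- A space has large inductive dimension at most zero if disjoint closed sets are separated
by clopen sets. -/
def ClopensSeparateClosed (X : Type*) [TopologicalSpace X] : Prop :=
  ∀ A B : Set X, IsClosed A → IsClosed B → Disjoint A B →
    ∃ C : Set X, IsClopen C ∧ A ⊆ C ∧ Disjoint C B

open Set Topology TopologicalSpace in
/-- In a second countable space with a basis of clopen sets, clopen sets separate disjoint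
closed sets. -/
theorem ClopensSeparateClosed.of_nhds {X : Type*} [TopologicalSpace X]
    [SecondCountableTopology X]
    (h : ∀ (x : X) (U : Set X), IsOpen U → x ∈ U → ∃ C, IsClopen C ∧ x ∈ C ∧ C ⊆ U) :
    ClopensSeparateClosed X := by
  intro A B hA hB hAB
  rcases isEmpty_or_nonempty X with hX | hX
  · exact ⟨∅, isClopen_empty, fun x => (hX.false x).elim, by simp⟩
  have key : ∀ x, ∃ C, IsClopen C ∧ x ∈ C ∧ (Disjoint C A ∨ Disjoint C B) := by
    intro x
    by_cases hx : x ∈ A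
    · obtain ⟨C, hC, hxC, hCU⟩ := h x Bᶜ hB.isOpen_compl (disjoint_left.1 hAB hx)
      exact ⟨C, hC, hxC, Or.inr (disjoint_left.2 hCU)⟩
    · obtain ⟨C, hC, hxC, hCU⟩ := h x Aᶜ hA.isOpen_compl hx
      exact ⟨C, hC, hxC, Or.inl (disjoint_left.2 hCU)⟩
  choose C hC hxC hCAB using key
  obtain ⟨s, hs, hsU⟩ := TopologicalSpace.countable_cover_nhds fun x => (hC x).isOpen.mem_nhds (hxC x)
  have hsne : s.Nonempty := by
    rw [nonempty_iff_ne_empty]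
    rintro rfl
    rw [biUnion_empty] at hsU
    exact empty_ne_univ hsU
  obtain ⟨u, rfl⟩ := hs.exists_eq_range hsne
  rw [biUnion_range] at hsU
  let D : ℕ → Set X := disjointed fun n => C (u n)
  have hD : ∀ n, IsOpen (D n) := fun n =>
    (disjointedRec (f := fun n => C (u n)) (p := IsClopen)
      (fun {t i} ht => ht.diff (hC (u i))) (hC (u n))).isOpen
  have hDU : ⋃ n, D n = univ := by rw [iUnion_disjointed, hsU]
  have hDd : Pairwise (Function.onFun Disjoint D) := disjoint_disjointed _
  let p : ℕ → Prop := fun n => Disjoint (C (u n)) B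
  have hcompl : (⋃ n ∈ {n | p n}, D n)ᶜ = ⋃ n ∈ {n | ¬ p n}, D n := by
    ext x
    obtain ⟨m, hm⟩ := mem_iUnion.1 (hDU.symm ▸ mem_univ x)
    have hu : ∀ k, x ∈ D k → k = m := fun k hk => by
      by_contra hkm
      exact disjoint_left.1 (hDd hkm) hk hm
    simp only [mem_compl_iff, mem_iUnion, mem_ofPred_eq, exists_prop]
    constructor
    · intro hx
      exact ⟨m, fun hp => hx ⟨m, hp, hm⟩, hm⟩
    · rintro ⟨k, hk, hxk⟩ ⟨l, hl, hxl⟩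
      rw [hu k hxk] at hk
      rw [hu l hxl] at hl
      exact hk hl
  refine ⟨⋃ n ∈ {n | p n}, D n, ⟨?_, isOpen_biUnion fun n _ => hD n⟩, ?_, ?_⟩
  · rw [← isOpen_compl_iff, hcompl]
    exact isOpen_biUnion fun n _ => hD n
  · intro x hx
    by_contra hxn
    rw [← mem_compl_iff, hcompl] at hxn
    simp only [mem_iUnion, mem_ofPred_eq, exists_prop] at hxn
    obtain ⟨k, hk, hxk⟩ := hxn
    have hxC : x ∈ C (u k) := disjointed_subset (fun n => C (u n)) k hxk
    exact (hCAB (u k)).elim (fun hd => disjoint_left.1 hd hxC hx) hk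
  · refine disjoint_left.2 fun x hx hxB => ?_
    simp only [mem_iUnion, mem_ofPred_eq, exists_prop] at hx
    obtain ⟨k, hk, hxk⟩ := hx
    exact disjoint_left.1 hk (disjointed_subset (fun n => C (u n)) k hxk) hxB

open Set Topology TopologicalSpace in
/-- The countable sum theorem for zero-dimensional closed pieces of a normal space. -/
theorem ClopensSeparateClosed.of_countable_closed_cover {Y : Type*} [TopologicalSpace Y]
    [NormalSpace Y] {Z : ℕ → Type*} [∀ i, TopologicalSpace (Z i)] (ψ : ∀ i, Z i → Y)
    (hψ : ∀ i, IsClosedEmbedding (ψ i)) (hZ : ∀ i, ClopensSeparateClosed (Z i))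
    (hcover : ⋃ i, range (ψ i) = univ) : ClopensSeparateClosed Y := by
  let P := {UV : Set Y × Set Y // IsOpen UV.1 ∧ IsOpen UV.2 ∧
    Disjoint (closure UV.1) (closure UV.2)}
  have grow : ∀ E F : Set Y, IsClosed E → IsClosed F → Disjoint E F →
      ∃ q : P, E ⊆ q.1.1 ∧ F ⊆ q.1.2 := by
    intro E F hE hF hEF
    obtain ⟨U, hU, hEU, hUF⟩ := normal_exists_closure_subset hE hF.isOpen_compl
      (disjoint_left.1 hEF)
    obtain ⟨V, hV, hFV, hVU⟩ := normal_exists_closure_subset hF isClosed_closure.isOpen_compl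
      (subset_compl_comm.1 hUF)
    exact ⟨⟨(U, V), hU, hV, disjoint_right.2 hVU⟩, hEU, hFV⟩
  have step : ∀ (i : ℕ) (q : P), ∃ q' : P, q.1.1 ⊆ q'.1.1 ∧ q.1.2 ⊆ q'.1.2 ∧
      range (ψ i) ⊆ q'.1.1 ∪ q'.1.2 := by
    rintro i ⟨⟨U, V⟩, hU, hV, hUV⟩
    obtain ⟨C, hC, hUC, hCV⟩ := hZ i (ψ i ⁻¹' closure U) (ψ i ⁻¹' closure V)
      (isClosed_closure.preimage (hψ i).continuous)
      (isClosed_closure.preimage (hψ i).continuous) (hUV.preimage _)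
    obtain ⟨q', h1, h2⟩ := grow (closure U ∪ ψ i '' C) (closure V ∪ ψ i '' Cᶜ)
      (isClosed_closure.union ((hψ i).isClosedMap _ hC.isClosed))
      (isClosed_closure.union ((hψ i).isClosedMap _ hC.compl.isClosed)) (by
        rw [disjoint_union_left, disjoint_union_right, disjoint_union_right]
        refine ⟨⟨hUV, ?_⟩, ?_, ?_⟩
        · rw [disjoint_left]
          rintro _ hx ⟨z, hz, rfl⟩
          exact hz (hUC hx)
        · rw [disjoint_left]
          rintro _ ⟨z, hz, rfl⟩ hx
          exact disjoint_left.1 hCV hz hx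
        · exact (disjoint_image_iff (hψ i).injective).2 disjoint_compl_right)
    refine ⟨q', subset_closure.trans (subset_union_left.trans h1),
      subset_closure.trans (subset_union_left.trans h2), ?_⟩
    rintro _ ⟨z, rfl⟩
    by_cases hz : z ∈ C
    · exact Or.inl (h1 (Or.inr ⟨z, hz, rfl⟩))
    · exact Or.inr (h2 (Or.inr ⟨z, hz, rfl⟩))
  choose next hn1 hn2 hn3 using step
  intro A B hA hB hAB
  obtain ⟨q₀, hq1, hq2⟩ := grow A B hA hB hAB
  let W : ℕ → P := fun m => Nat.rec q₀ (fun i q => next i q) m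
  have hmono1 : Monotone fun m => (W m).1.1 := monotone_nat_of_le_succ fun m => hn1 m (W m)
  have hmono2 : Monotone fun m => (W m).1.2 := monotone_nat_of_le_succ fun m => hn2 m (W m)
  have hdisj : Disjoint (⋃ m, (W m).1.1) (⋃ m, (W m).1.2) := by
    rw [disjoint_left]
    intro x hx hx'
    obtain ⟨k, hk⟩ := mem_iUnion.1 hx
    obtain ⟨l, hl⟩ := mem_iUnion.1 hx'
    exact disjoint_left.1 (W (max k l)).2.2.2
      (subset_closure (hmono1 (le_max_left k l) hk))
      (subset_closure (hmono2 (le_max_right k l) hl))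
  have hcov : ∀ x, x ∉ (⋃ m, (W m).1.1) → x ∈ ⋃ m, (W m).1.2 := by
    intro x hx
    obtain ⟨i, hi⟩ := mem_iUnion.1 (hcover.symm ▸ mem_univ x)
    rcases hn3 i (W i) hi with h | h
    · exact (hx (mem_iUnion.2 ⟨i + 1, h⟩)).elim
    · exact mem_iUnion.2 ⟨i + 1, h⟩
  have hcompl : (⋃ m, (W m).1.1)ᶜ = ⋃ m, (W m).1.2 :=
    Subset.antisymm hcov (disjoint_right.1 hdisj)
  refine ⟨⋃ m, (W m).1.1, ⟨?_, isOpen_iUnion fun m => (W m).2.1⟩,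
    hq1.trans (subset_iUnion (fun m => (W m).1.1) 0),
    hdisj.mono_right (hq2.trans (subset_iUnion (fun m => (W m).1.2) 0))⟩
  rw [← isOpen_compl_iff, hcompl]
  exact isOpen_iUnion fun m => (W m).2.2.1

open Set Topology TopologicalSpace in
/-- A zero-dimensional second countable regular space embeds in the real line. -/
theorem ClopensSeparateClosed.exists_isEmbedding_real {Y : Type*} [TopologicalSpace Y]
    [T3Space Y] [SecondCountableTopology Y] (h : ClopensSeparateClosed Y) :
    ∃ g : Y → ℝ, IsEmbedding g := by
  classical
  let b := countableBasis Y
  have key : ∀ p : b × b, ∃ C : Set Y, IsClopen C ∧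
      (closure (p.1 : Set Y) ⊆ p.2 → closure (p.1 : Set Y) ⊆ C ∧ C ⊆ p.2) := by
    rintro ⟨⟨U, hU⟩, ⟨V, hV⟩⟩
    by_cases hUV : closure U ⊆ V
    · obtain ⟨C, hC, h1, h2⟩ := h (closure U) Vᶜ isClosed_closure
        (isOpen_of_mem_countableBasis hV).isClosed_compl
        (disjoint_compl_right_iff_subset.2 hUV)
      exact ⟨C, hC, fun _ => ⟨h1, disjoint_compl_right_iff_subset.1 h2⟩⟩
    · exact ⟨∅, isClopen_empty, fun h => (hUV h).elim⟩
  choose C hC hCs using key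
  have : Countable b := (countable_countableBasis Y).to_subtype
  obtain ⟨e, he⟩ := exists_injective_nat (b × b)
  let D : ℕ → Set Y := fun m => {x | ∃ p, e p = m ∧ x ∈ C p}
  have hDe : ∀ p, D (e p) = C p := fun p => by
    ext x
    constructor
    · rintro ⟨p', hp', hx⟩
      rwa [← he hp']
    · exact fun hx => ⟨p, rfl, hx⟩
  have hD : ∀ m, IsClopen (D m) := fun m => by
    by_cases hm : ∃ p, e p = m
    · obtain ⟨p, rfl⟩ := hm
      rw [hDe]
      exact hC p
    · convert isClopen_empty (X := Y)
      ext x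
      simp only [D, mem_ofPred_eq, mem_empty_iff_false, iff_false]
      rintro ⟨p, hp, -⟩
      exact hm ⟨p, hp⟩
  let F : Y → ℕ → Bool := fun x m => decide (x ∈ D m)
  have hF : Continuous F := by
    refine continuous_pi fun m => ?_
    refine (continuous_bool_rng true).2 ?_
    convert hD m using 1
    ext x
    simp [F]
  have hind : IsInducing F := by
    refine isInducing_iff_nhds.2 fun x => le_antisymm (hF.tendsto x).le_comap ?_
    intro V hV
    obtain ⟨V', hV', hxV', hVV⟩ := (isBasis_countableBasis Y).mem_nhds_iff.1 hV
    obtain ⟨K, hK, hKc, hKV⟩ := exists_mem_nhds_isClosed_subset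
      ((isOpen_of_mem_countableBasis hV').mem_nhds hxV')
    obtain ⟨U, hU, hxU, hUK⟩ := (isBasis_countableBasis Y).mem_nhds_iff.1 hK
    obtain ⟨h1, h2⟩ := hCs (⟨U, hU⟩, ⟨V', hV'⟩) ((closure_minimal hUK hKc).trans hKV)
    let m := e (⟨U, hU⟩, ⟨V', hV'⟩)
    have hm : D m = C (⟨U, hU⟩, ⟨V', hV'⟩) := hDe _
    refine Filter.mem_comap.2 ⟨{z | z m = true}, ?_, ?_⟩
    · refine ((isOpen_discrete ({true} : Set Bool)).preimage
        (continuous_apply (A := fun _ : ℕ => Bool) m)).mem_nhds ?_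
      have : x ∈ D m := hm ▸ h1 (subset_closure hxU)
      simpa [F] using this
    · intro y hy
      have hy' : y ∈ D m := by simpa [F] using hy
      exact hVV (h2 (hm ▸ hy'))
  exact ⟨_, IsEmbedding.subtypeVal.comp
    (cantorSetHomeomorphNatToBool.symm.isEmbedding.comp hind.isEmbedding)⟩

open Set Topology TopologicalSpace in
/-- A set of points each of whose coordinates is either constant or always irrational is
zero-dimensional. -/
theorem ClopensSeparateClosed.of_coordinates {n : ℕ} {Z : Set (EuclideanSpace ℝ (Fin n))}
    (hZ : ∀ j, (∀ p ∈ Z, ∀ p' ∈ Z, p j = p' j) ∨ ∀ p ∈ Z, Irrational (p j)) :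
    ClopensSeparateClosed Z := by
  refine ClopensSeparateClosed.of_nhds fun x U hU hx => ?_
  have hind : IsInducing fun p : Z => (fun j => p.1 j : Fin n → ℝ) :=
    (PiLp.homeomorph 2 fun _ : Fin n => ℝ).isInducing.comp IsInducing.subtypeVal
  have hcont : ∀ j, Continuous fun p : Z => p.1 j := fun j =>
    (continuous_apply j).comp hind.continuous
  obtain ⟨T, hT, hTU⟩ := Filter.mem_comap.1 (hind.nhds_eq_comap x ▸ hU.mem_nhds hx)
  rw [nhds_pi, Filter.mem_pi'] at hT
  obtain ⟨I, t, ht, hIT⟩ := hT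
  have key : ∀ j, ∃ C : Set Z, IsClopen C ∧ x ∈ C ∧ ∀ p ∈ C, p.1 j ∈ t j := by
    intro j
    rcases hZ j with h | h
    · exact ⟨univ, isClopen_univ, mem_univ x, fun p _ =>
        h x x.2 p p.2 ▸ mem_of_mem_nhds (ht j)⟩
    · obtain ⟨l, u, hxlu, hlu⟩ := mem_nhds_iff_exists_Ioo_subset.1 (ht j)
      obtain ⟨a, hla, hax⟩ := exists_rat_btwn hxlu.1
      obtain ⟨c, hxc, hcu⟩ := exists_rat_btwn hxlu.2
      refine ⟨(fun p : Z => p.1 j) ⁻¹' Ioo (a : ℝ) c, ⟨?_, isOpen_Ioo.preimage (hcont j)⟩,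
        ⟨hax, hxc⟩, fun p hp => hlu ⟨hla.trans hp.1, hp.2.trans hcu⟩⟩
      convert isClosed_Icc.preimage (hcont j) (t := Icc (a : ℝ) c) using 1
      ext p
      exact ⟨fun hp => ⟨hp.1.le, hp.2.le⟩, fun hp =>
        ⟨lt_of_le_of_ne hp.1 ((h p p.2).ne_rat a).symm,
          lt_of_le_of_ne hp.2 ((h p p.2).ne_rat c)⟩⟩
  choose C hC hxC hCt using key
  exact ⟨⋂ j, C j, isClopen_iInter_of_finite hC, mem_iInter.2 hxC, fun p hp =>
    hTU (hIT fun j _ => hCt j p (mem_iInter.1 hp j))⟩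

open Classical in
/-- The coordinates at which a point of Euclidean space is rational. -/
noncomputable def rationalCoordinates {n : ℕ} (p : EuclideanSpace ℝ (Fin n)) : Finset (Fin n) :=
  {j | ∃ q : ℚ, p j = q}

/-- The classes of `S` whose points have at most `k` rational coordinates, with `k` attained. -/
def classesOfRank {n : ℕ} (S : Setoid (EuclideanSpace ℝ (Fin n))) (k : ℕ) : Set (Quotient S) :=
  {y | (∃ p, Quotient.mk S p = y ∧ (rationalCoordinates p).card = k) ∧
    ∀ p, Quotient.mk S p = y → (rationalCoordinates p).card ≤ k}

theorem exists_mem_classesOfRank {n : ℕ} (S : Setoid (EuclideanSpace ℝ (Fin n)))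
    (y : Quotient S) : ∃ k : Fin (n + 1), y ∈ classesOfRank S k := by
  let R : Set ℕ := (fun p => (rationalCoordinates p).card) '' {p | Quotient.mk S p = y}
  have hb : ∀ m ∈ R, m ≤ n := by
    rintro _ ⟨p, -, rfl⟩
    simpa using Finset.card_le_univ (rationalCoordinates p)
  have hne : R.Nonempty := by
    obtain ⟨p, hp⟩ := Quotient.exists_rep y
    exact ⟨_, p, hp, rfl⟩
  have hmem : sSup R ∈ R := Nat.sSup_mem hne ⟨n, hb⟩
  refine ⟨⟨sSup R, Nat.lt_succ_of_le (hb _ hmem)⟩, ?_, fun p hp => ?_⟩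
  · obtain ⟨p, hp, hpR⟩ := hmem
    exact ⟨p, hp, hpR⟩
  · exact le_csSup ⟨n, hb⟩ ⟨p, hp, rfl⟩

/-- The points of classes of rank `k` whose coordinates in `J` are prescribed by `q`. -/
def rationalSlice {n : ℕ} (S : Setoid (EuclideanSpace ℝ (Fin n))) (k : ℕ)
    (J : Finset (Fin n)) (q : Fin n → ℚ) : Set (EuclideanSpace ℝ (Fin n)) :=
  {p | Quotient.mk S p ∈ classesOfRank S k ∧ ∀ j ∈ J, p j = q j}

theorem rationalCoordinates_eq_of_mem_rationalSlice {n : ℕ}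
    {S : Setoid (EuclideanSpace ℝ (Fin n))} {k : ℕ} {J : Finset (Fin n)} {q : Fin n → ℚ}
    (hJ : J.card = k) {p : EuclideanSpace ℝ (Fin n)} (hp : p ∈ rationalSlice S k J q) :
    rationalCoordinates p = J := by
  refine (Finset.eq_of_subset_of_card_le (fun j hj => ?_) ?_).symm
  · simpa [rationalCoordinates] using ⟨q j, hp.2 j hj⟩
  · exact hJ ▸ hp.1.2 p rfl

theorem rationalSlice_clopensSeparateClosed {n : ℕ} {S : Setoid (EuclideanSpace ℝ (Fin n))}
    {k : ℕ} {J : Finset (Fin n)} (q : Fin n → ℚ) (hJ : J.card = k) :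
    ClopensSeparateClosed (rationalSlice S k J q) := by
  refine ClopensSeparateClosed.of_coordinates fun j => ?_
  by_cases hj : j ∈ J
  · exact Or.inl fun p hp p' hp' => (hp.2 j hj).trans (hp'.2 j hj).symm
  · refine Or.inr fun p hp => ?_
    rintro ⟨r, hr⟩
    rw [← rationalCoordinates_eq_of_mem_rationalSlice hJ hp] at hj
    exact hj (by simpa [rationalCoordinates] using ⟨r, hr.symm⟩)

/-- Two points of one convex class in one slice coincide: otherwise the segment joining them
would contain a point with an additional rational coordinate. -/
theorem rationalSlice_injOn {n : ℕ} {S : Setoid (EuclideanSpace ℝ (Fin n))}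
    (hconvex : ∀ x, Convex ℝ {y | S x y}) {k : ℕ} {J : Finset (Fin n)} {q : Fin n → ℚ}
    (hJ : J.card = k) : Set.InjOn (Quotient.mk S) (rationalSlice S k J q) := by
  intro p hp p' hp' hpp'
  by_contra hne
  obtain ⟨j, hj⟩ : ∃ j, p j ≠ p' j := by
    by_contra! h
    exact hne (PiLp.ext h)
  have hjJ : j ∉ J := fun h => hj ((hp.2 j h).trans (hp'.2 j h).symm)
  wlog hlt : p j < p' j generalizing p p'
  · exact this hp' hp hpp'.symm (Ne.symm hne) hj.symm (lt_of_le_of_ne (not_lt.1 hlt) hj.symm)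
  obtain ⟨r, hr1, hr2⟩ := exists_rat_btwn hlt
  have hd : 0 < p' j - p j := sub_pos.2 hlt
  let t : ℝ := (r - p j) / (p' j - p j)
  have ht0 : 0 ≤ t := div_nonneg (by linarith) hd.le
  have ht1 : t ≤ 1 := (div_le_one hd).2 (by linarith)
  let s : EuclideanSpace ℝ (Fin n) := (1 - t) • p + t • p'
  have hs : S p s := hconvex p (S.refl p) (Quotient.exact hpp') (sub_nonneg.2 ht1) ht0 (by ring)
  have hsi : ∀ i, s i = (1 - t) * p i + t * p' i := fun i => by simp [s]
  have hsj : s j = r := by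
    rw [hsi]
    have : t * (p' j - p j) = r - p j := div_mul_cancel₀ _ hd.ne'
    linarith
  have hsub : insert j J ⊆ rationalCoordinates s := by
    intro i hi
    rcases Finset.mem_insert.1 hi with rfl | hi
    · simpa [rationalCoordinates] using ⟨r, hsj⟩
    · have : s i = q i := by
        rw [hsi, hp.2 i hi, hp'.2 i hi]
        ring
      simpa [rationalCoordinates] using ⟨q i, this⟩
  have h1 := Finset.card_le_card hsub
  rw [Finset.card_insert_of_notMem hjJ, hJ] at h1
  have h2 := hp.1.2 s (Quotient.sound (S.symm hs))
  omega

open Topology in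
theorem rationalSlice_isClosedEmbedding {n : ℕ} {S : Setoid (EuclideanSpace ℝ (Fin n))}
    (hconvex : ∀ x, Convex ℝ {y | S x y}) (hproper : IsProperMap (Quotient.mk S)) {k : ℕ}
    {J : Finset (Fin n)} (q : Fin n → ℚ) (hJ : J.card = k) :
    IsClosedEmbedding fun p : rationalSlice S k J q =>
      (⟨Quotient.mk S p.1, p.2.1⟩ : classesOfRank S k) := by
  refine IsClosedEmbedding.of_continuous_injective_isClosedMap
    ((hproper.continuous.comp continuous_subtype_val).subtype_mk _) ?_ ?_
  · intro p p' h
    exact Subtype.ext (rationalSlice_injOn hconvex hJ p.2 p'.2 (congrArg Subtype.val h))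
  · intro C hC
    obtain ⟨C', hC', rfl⟩ := isClosed_induced_iff.1 hC
    have hH : IsClosed {p : EuclideanSpace ℝ (Fin n) | ∀ j ∈ J, p j = q j} := by
      simp only [Set.ofPred_forall]
      exact isClosed_iInter fun j => isClosed_iInter fun _ =>
        isClosed_eq (by fun_prop) continuous_const
    refine isClosed_induced_iff.2 ⟨_, hproper.isClosedMap _ (hC'.inter hH), ?_⟩
    ext ⟨y, hy⟩
    constructor
    · rintro ⟨p, ⟨hpC, hpH⟩, hpy⟩
      obtain rfl : Quotient.mk S p = y := hpy
      exact ⟨⟨p, hy, hpH⟩, hpC, rfl⟩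
    · rintro ⟨p, hpC, hpy⟩
      exact ⟨p.1, ⟨hpC, p.2.2⟩, congrArg Subtype.val hpy⟩

open Topology TopologicalSpace in
theorem classesOfRank_exists_isEmbedding_real {n : ℕ} {S : Setoid (EuclideanSpace ℝ (Fin n))}
    (hconvex : ∀ x, Convex ℝ {y | S x y}) (hproper : IsProperMap (Quotient.mk S)) (k : ℕ) :
    ∃ g : classesOfRank S k → ℝ, IsEmbedding g := by
  have hsurj : Function.Surjective (Quotient.mk S) := Quotient.exists_rep
  have : NormalSpace (Quotient S) :=
    hproper.isClosedMap.normalSpace_of_surjective hproper.continuous hsurj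
  have : SecondCountableTopology (Quotient S) :=
    hproper.secondCountableTopology_of_surjective hsurj
  have : T1Space (Quotient S) := ⟨fun y => by
    obtain ⟨p, rfl⟩ := hsurj y
    simpa using hproper.isClosedMap _ (isClosed_singleton (x := p))⟩
  have : T4Space (Quotient S) := {}
  have : NormalSpace (classesOfRank S k) := inferInstance
  let ι := {J : Finset (Fin n) // J.card = k} × (Fin n → ℚ)
  rcases isEmpty_or_nonempty ι with hι | hι
  · have : IsEmpty (classesOfRank S k) := ⟨fun ⟨y, ⟨p, _, hp⟩, _⟩ =>
      hι.false (⟨_, hp⟩, fun _ => 0)⟩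
    exact ⟨fun _ => 0, IsEmbedding.of_subsingleton _⟩
  obtain ⟨e, he⟩ := exists_surjective_nat ι
  refine ClopensSeparateClosed.exists_isEmbedding_real
    (ClopensSeparateClosed.of_countable_closed_cover
      (fun i => fun p : rationalSlice S k (e i).1 (e i).2 =>
        (⟨Quotient.mk S p.1, p.2.1⟩ : classesOfRank S k))
      (fun i => rationalSlice_isClosedEmbedding hconvex hproper _ (e i).1.2)
      (fun i => rationalSlice_clopensSeparateClosed _ (e i).1.2) ?_)
  refine Set.eq_univ_of_forall ?_
  rintro ⟨y, hy⟩
  obtain ⟨p, hpy, hpk⟩ := hy.1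
  have hq : ∀ j, ∃ q : ℚ, j ∈ rationalCoordinates p → p j = q := fun j => by
    by_cases hj : j ∈ rationalCoordinates p
    · obtain ⟨q, hq⟩ : ∃ q : ℚ, p j = q := by simpa [rationalCoordinates] using hj
      exact ⟨q, fun _ => hq⟩
    · exact ⟨0, fun h => (hj h).elim⟩
  choose q hq using hq
  obtain ⟨i, hi⟩ := he (⟨_, hpk⟩, q)
  refine Set.mem_iUnion.2 ⟨i, ⟨p, hpy ▸ hy, ?_⟩, Subtype.ext hpy⟩
  rw [hi]
  exact hq


/-- If `G` is an upper semicontinuous decomposition of `ℝⁿ`, `n ≥ 2`, into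
compact convex sets, then the maps `f' : D² → ℝⁿ/G` whose image is a finite union of sets,
each topologically embeddable in `ℝ²`, are dense in `C(D², ℝⁿ/G)` (compact-open topology). -/
theorem convex_decomposition_dense_two_dimensional_images
    (n : ℕ) (hn : 2 ≤ n) (S : Setoid (EuclideanSpace ℝ (Fin n)))
    (hcompact : ∀ x, IsCompact {y | S x y})
    (hconvex : ∀ x, Convex ℝ {y | S x y})
    (hproper : IsProperMap (Quotient.mk S)) :
    Dense {f' : C((Metric.closedBall (0 : EuclideanSpace ℝ (Fin 2)) 1 :
        Set (EuclideanSpace ℝ (Fin 2))), Quotient S) |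
      ∃ (k : ℕ) (A : Fin k → Set (Quotient S)),
        Set.range f' = ⋃ i, A i ∧
        ∀ i, ∃ g : (A i) → EuclideanSpace ℝ (Fin 2), Topology.IsEmbedding g} := by
  refine fun f => subset_closure ⟨n + 1, fun k => Set.range f ∩ classesOfRank S k, ?_, fun k => ?_⟩
  · rw [← Set.inter_iUnion]
    exact (Set.inter_eq_left.2 fun y _ => Set.mem_iUnion.2 (exists_mem_classesOfRank S y)).symm
  · obtain ⟨g, hg⟩ := classesOfRank_exists_isEmbedding_real hconvex hproper k
    have hline : Topology.IsEmbedding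
        fun t : ℝ => (EuclideanSpace.single 0 t : EuclideanSpace ℝ (Fin 2)) :=
      (Isometry.of_dist_eq fun a b => by simp).isEmbedding
    exact ⟨_, hline.comp (hg.comp (Topology.IsEmbedding.inclusion Set.inter_subset_right))⟩
end
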